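/- arXiv:2401.00048 — 2 statements merged into one kernel-verified Lean document; each statement's English description precedes it below -/
import Mathlib

section
/- Assume the Reissner–Nordström radial setup stated in the context. For every δ ∈ (0, 1) there exist s₀* < 0 and C > 0, depending only on δ, M, 𝐞, m, such that for all sufficiently large integers L, all ω ∈ ℝ with ω² < m², all s₀ ≤ s₀*, and every weakly outgoing C² solution u of u'' − V(ω, L, ·)·u = H, one has ∫_{−∞}^{s₀−1} [ (r − r₊)⁻¹·|u' + iωu|² + L²·(1 + |s|)^{−1−δ}·|u|² ] ds ≤ C·( ∫_{−∞}^{s₀} (r − r₊)⁻¹·|H|² ds + L²·∫_{s₀−1}^{s₀} |u|² ds ). -/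
open MeasureTheory Filter Set

/-- The radial Klein–Gordon potential on a subextremal Reissner–Nordström exterior,
expressed in the tortoise-type coordinate `s` via the inverse map `rofs = r(s)`. -/
noncomputable def Vpot (M m E : ℝ) (rofs : ℝ → ℝ) (ω : ℝ) (L : ℕ) (s : ℝ) : ℝ :=
  -ω ^ 2 + (1 - 2 * M / rofs s + E ^ 2 / rofs s ^ 2) *
    (m ^ 2 + ((L : ℝ) * ((L : ℝ) + 1)) / rofs s ^ 2 +
      (2 * M * rofs s - 2 * E ^ 2) / rofs s ^ 4)

/-- `u` is weakly outgoing: `u ∼ c·e^{−iωs}` (with its derivative) as `s → −∞`, and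
`u` together with `u'` decays exponentially as `s → +∞`. -/
def WeaklyOutgoing (ω : ℝ) (u : ℝ → ℂ) : Prop :=
  (∃ c : ℂ,
    Filter.Tendsto (fun s : ℝ => u s - c * Complex.exp (-Complex.I * (ω : ℂ) * (s : ℂ)))
      Filter.atBot (nhds 0) ∧
    Filter.Tendsto (fun s : ℝ =>
        deriv u s + Complex.I * (ω : ℂ) * c * Complex.exp (-Complex.I * (ω : ℂ) * (s : ℂ)))
      Filter.atBot (nhds 0)) ∧
  ∃ ε : ℝ, 0 < ε ∧
    Filter.Tendsto (fun s : ℝ => Real.exp (ε * s) * (‖u s‖ + ‖deriv u s‖))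
      Filter.atTop (nhds 0)

/-- Tails at `-∞` of an integrable continuous nonnegative function are eventually small. -/
lemma eventually_forall_intervalIntegral_le_of_integrableOn_Iic {K : ℝ → ℝ} {b : ℝ}
    (hKc : Continuous K) (hK0 : ∀ s, 0 ≤ K s) (hK : IntegrableOn K (Iic b))
    {η : ℝ} (hη : 0 < η) :
    ∀ᶠ s in atBot, ∀ a ≤ s, ∫ t in a..s, K t ≤ η := by
  have hlim := intervalIntegral_tendsto_integral_Iic (a := fun i : ℝ => i) b hK tendsto_id
  have hKi : ∀ p q : ℝ, IntervalIntegrable K volume p q := fun p q => hKc.intervalIntegrable p q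
  have hle : ∀ a, ∫ t in a..b, K t ≤ ∫ t in Iic b, K t := by
    intro a
    refine ge_of_tendsto hlim ?_
    filter_upwards [eventually_le_atBot a] with a' ha'
    have h1 := intervalIntegral.integral_add_adjacent_intervals (hKi a' a) (hKi a b)
    have h2 := intervalIntegral.integral_nonneg (μ := volume) ha' (fun t _ => hK0 t)
    linarith
  have hev := hlim.eventually (lt_mem_nhds (sub_lt_self (∫ t in Iic b, K t) hη))
  filter_upwards [hev] with s hs a _
  have h1 := intervalIntegral.integral_add_adjacent_intervals (hKi a s) (hKi s b)
  have h2 := hle a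
  linarith

/-- If `Z → 0` at `-∞` and `‖Z'‖ ≤ B x + ‖H‖` with `x` growing at least exponentially and
`x⁻¹ ‖H‖²` integrable near `-∞`, then `‖Z‖² = o(x)` at `-∞`. -/
lemma tendsto_inv_mul_norm_sq_atBot {x x' : ℝ → ℝ} {Z Z' H : ℝ → ℂ} {c₀ B b : ℝ}
    (hc₀ : 0 < c₀) (hB : 0 ≤ B) (hx : ∀ s, 0 < x s) (hxd : ∀ s, HasDerivAt x (x' s) s)
    (hx' : ∀ s ≤ b, c₀ * x s ≤ x' s) (hx0 : Tendsto x atBot (nhds 0))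
    (hH : Continuous H) (hK : IntegrableOn (fun s => (x s)⁻¹ * ‖H s‖ ^ 2) (Iic b))
    (hZd : ∀ s, HasDerivAt Z (Z' s) s) (hZ' : ∀ s ≤ b, ‖Z' s‖ ≤ B * x s + ‖H s‖)
    (hZ0 : Tendsto Z atBot (nhds 0)) :
    Tendsto (fun s => (x s)⁻¹ * ‖Z s‖ ^ 2) atBot (nhds 0) := by
  have hxc : Continuous x := continuous_iff_continuousAt.2 fun s => (hxd s).continuousAt
  have hKc : Continuous fun s => (x s)⁻¹ * ‖H s‖ ^ 2 :=
    (hxc.inv₀ fun s => (hx s).ne').mul (hH.norm.pow 2)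
  have hK0 : ∀ s, 0 ≤ (x s)⁻¹ * ‖H s‖ ^ 2 := fun s =>
    mul_nonneg (inv_nonneg.2 (hx s).le) (sq_nonneg _)
  have key : ∀ l : ℝ, 0 < l → ∀ η : ℝ, 0 ≤ η → ∀ s ≤ b,
      (∀ a ≤ s, ∫ t in a..s, (x t)⁻¹ * ‖H t‖ ^ 2 ≤ η) →
      ‖Z s‖ ≤ (B + l) / c₀ * x s + l⁻¹ * η := by
    intro l hl η hη s hs hT
    have hb : ∀ a ≤ s, ‖Z s‖ ≤ ‖Z a‖ + ((B + l) / c₀ * x s + l⁻¹ * η) := by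
      intro a ha
      have hI : ∀ t, HasDerivAt (fun t => ∫ y in a..t, (x y)⁻¹ * ‖H y‖ ^ 2)
          ((x t)⁻¹ * ‖H t‖ ^ 2) t := fun t =>
        intervalIntegral.integral_hasDerivAt_right (hKc.intervalIntegrable _ _)
          (hKc.stronglyMeasurableAtFilter _ _) hKc.continuousAt
      have := image_norm_le_of_norm_deriv_right_le_deriv_boundary (f := Z) (f' := Z')
        (a := a) (b := s)
        (B := fun t => ‖Z a‖ + ((B + l) / c₀ * x t
          + l⁻¹ * ∫ y in a..t, (x y)⁻¹ * ‖H y‖ ^ 2))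
        (B' := fun t => (B + l) / c₀ * x' t + l⁻¹ * ((x t)⁻¹ * ‖H t‖ ^ 2))
        (fun t _ => (hZd t).continuousAt.continuousWithinAt)
        (fun t _ => (hZd t).hasDerivWithinAt)
        (by
          have := (hx a).le
          simp only [intervalIntegral.integral_same, mul_zero, add_zero]
          have : 0 ≤ (B + l) / c₀ * x a := by positivity
          linarith)
        (fun t => (((hxd t).const_mul _).add ((hI t).const_mul _)).const_add _)
        (by
          intro t ht
          have htb : t ≤ b := ht.2.le.trans hs
          have hxt := hx t
          refine (hZ' t htb).trans ?_
          have h1 : (B + l) * x t ≤ (B + l) / c₀ * x' t := by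
            have : (B + l) / c₀ * (c₀ * x t) ≤ (B + l) / c₀ * x' t :=
              mul_le_mul_of_nonneg_left (hx' t htb) (by positivity)
            calc (B + l) * x t = (B + l) / c₀ * (c₀ * x t) := by field_simp
              _ ≤ _ := this
          have h2 : ‖H t‖ ≤ l * x t + l⁻¹ * ((x t)⁻¹ * ‖H t‖ ^ 2) := by
            have h3 : l * x t * ‖H t‖ ≤ (l * x t) ^ 2 + ‖H t‖ ^ 2 := by
              nlinarith [sq_nonneg (l * x t - ‖H t‖), mul_pos hl hxt,
                norm_nonneg (H t), mul_nonneg (mul_pos hl hxt).le (norm_nonneg (H t))]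
            have h4 : l * x t + l⁻¹ * ((x t)⁻¹ * ‖H t‖ ^ 2)
                = ((l * x t) ^ 2 + ‖H t‖ ^ 2) / (l * x t) := by field_simp
            rw [h4, le_div_iff₀ (mul_pos hl hxt)]
            linarith
          linarith)
        (right_mem_Icc.2 ha)
      refine this.trans ?_
      have := mul_le_mul_of_nonneg_left (hT a ha) (inv_nonneg.2 hl.le)
      linarith
    have hlim : Tendsto (fun a => ‖Z a‖ + ((B + l) / c₀ * x s + l⁻¹ * η)) atBot
        (nhds (0 + ((B + l) / c₀ * x s + l⁻¹ * η))) := by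
      simpa using (hZ0.norm).add_const ((B + l) / c₀ * x s + l⁻¹ * η)
    have := ge_of_tendsto hlim (by filter_upwards [eventually_le_atBot s] with a ha using hb a ha)
    linarith
  rw [Metric.tendsto_nhds]
  intro ε hε
  obtain ⟨e, he, heε⟩ : ∃ e > 0, (e / c₀ + 2 * e) ^ 2 < ε := by
    have hc : Tendsto (fun e : ℝ => (e / c₀ + 2 * e) ^ 2) (nhdsWithin 0 (Ioi 0)) (nhds 0) := by
      have : Continuous fun e : ℝ => (e / c₀ + 2 * e) ^ 2 := by fun_prop
      have h := this.tendsto 0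
      simp only [zero_div, mul_zero, add_zero, ne_eq, OfNat.ofNat_ne_zero, not_false_eq_true,
        zero_pow] at h
      exact h.mono_left nhdsWithin_le_nhds
    obtain ⟨e, h1, h2⟩ := ((hc.eventually (gt_mem_nhds hε)).and self_mem_nhdsWithin).exists
    exact ⟨e, h2, h1⟩
  have hsq : Tendsto (fun s => B / c₀ * √(x s)) atBot (nhds 0) := by
    have := (hx0.sqrt).const_mul (B / c₀)
    simpa using this
  filter_upwards [eventually_le_atBot b,
    eventually_forall_intervalIntegral_le_of_integrableOn_Iic hKc hK0 hK (pow_pos he 2),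
    hsq.eventually (gt_mem_nhds he)] with s hs hT hsm
  have hq : 0 < √(x s) := Real.sqrt_pos.2 (hx s)
  have hqq : √(x s) ^ 2 = x s := Real.sq_sqrt (hx s).le
  have h1 := key (e / √(x s)) (by positivity) (e ^ 2) (by positivity) s hs hT
  have h2 : ‖Z s‖ ≤ (e / c₀ + 2 * e) * √(x s) := by
    refine h1.trans ?_
    have h3 : (B + e / √(x s)) / c₀ * x s + (e / √(x s))⁻¹ * e ^ 2
        = (B / c₀ * √(x s) + (e / c₀ + e)) * √(x s) := by
      have h5 : ∀ q : ℝ, 0 < q → (B + e / q) / c₀ * q ^ 2 + (e / q)⁻¹ * e ^ 2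
          = (B / c₀ * q + (e / c₀ + e)) * q := by
        intro q hq
        field_simp
        ring
      have h6 := h5 _ hq
      rwa [hqq] at h6
    rw [h3]
    apply mul_le_mul_of_nonneg_right _ hq.le
    linarith
  rw [Real.dist_eq, sub_zero, abs_of_nonneg (by have := hx s; positivity)]
  have h4 : ‖Z s‖ ^ 2 ≤ (e / c₀ + 2 * e) ^ 2 * x s := by
    calc ‖Z s‖ ^ 2 ≤ ((e / c₀ + 2 * e) * √(x s)) ^ 2 := by gcongr
      _ = _ := by rw [mul_pow, hqq]
  calc (x s)⁻¹ * ‖Z s‖ ^ 2 ≤ (x s)⁻¹ * ((e / c₀ + 2 * e) ^ 2 * x s) :=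
        mul_le_mul_of_nonneg_left h4 (inv_nonneg.2 (hx s).le)
    _ = (e / c₀ + 2 * e) ^ 2 := by have := (hx s).ne'; field_simp
    _ < ε := heε

/-- An integral inequality on compact intervals with a boundary term vanishing at `-∞`, averaged
over the position of the right endpoint. -/
lemma lintegral_Iic_le_of_integral_le {G K P N : ℝ → ℝ} {s₀ c₁ c₂ c₃ : ℝ}
    (hG : Continuous G) (hG0 : ∀ s ≤ s₀, 0 ≤ G s) (hK : IntegrableOn K (Iic s₀))
    (hK0 : ∀ s, 0 ≤ K s) (hP : Tendsto P atBot (nhds 0))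
    (hN : Continuous N)
    (hN0 : ∀ s, 0 ≤ N s) (hc₁ : 0 < c₁) (hc₂ : 0 ≤ c₂) (hc₃ : 0 ≤ c₃)
    (h : ∀ a b, a ≤ b → b ≤ s₀ →
      c₁ * ∫ s in a..b, G s ≤ c₂ * (∫ s in a..b, K s) + P a + c₃ * N b) :
    ∫⁻ s in Iic (s₀ - 1), ENNReal.ofReal (G s)
      ≤ ENNReal.ofReal (c₁⁻¹ * c₂) * (∫⁻ s in Iic s₀, ENNReal.ofReal (K s))
        + ENNReal.ofReal (c₁⁻¹ * c₃) * ∫⁻ s in Icc (s₀ - 1) s₀, ENNReal.ofReal (N s) := by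
  set I := ∫ s in Iic s₀, K s with hI
  have hI' : ENNReal.ofReal I = ∫⁻ s in Iic s₀, ENNReal.ofReal (K s) :=
    ofReal_integral_eq_lintegral_ofReal hK (Eventually.of_forall hK0)
  have hI0 : 0 ≤ I := integral_nonneg hK0
  have hpt : ∀ b ≤ s₀, ∫⁻ s in Iic b, ENNReal.ofReal (G s)
      ≤ ENNReal.ofReal (c₁⁻¹ * c₂ * I + c₁⁻¹ * c₃ * N b) := by
    intro b hb
    have h1 : Tendsto (fun a => ∫⁻ s in Ioc a b, ENNReal.ofReal (G s)) atBot
        (nhds (∫⁻ s in Iic b, ENNReal.ofReal (G s))) := by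
      have := ((aecover_Ioi (μ := (volume : Measure ℝ)) (a := fun a : ℝ => a)
        (l := atBot) tendsto_id).restrict
        (s := Iic b)).lintegral_tendsto_of_countably_generated
        (f := fun s => ENNReal.ofReal (G s)) hG.measurable.ennreal_ofReal.aemeasurable
      simpa only [Measure.restrict_restrict measurableSet_Ioi, Ioi_inter_Iic] using this
    have h2 : Tendsto (fun a => ENNReal.ofReal (c₁⁻¹ * c₂ * I + c₁⁻¹ * P a + c₁⁻¹ * c₃ * N b))
        atBot (nhds (ENNReal.ofReal (c₁⁻¹ * c₂ * I + c₁⁻¹ * 0 + c₁⁻¹ * c₃ * N b))) :=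
      ENNReal.tendsto_ofReal (((hP.const_mul c₁⁻¹).const_add _).add_const _)
    rw [mul_zero, add_zero] at h2
    refine le_of_tendsto_of_tendsto h1 h2 ?_
    filter_upwards [eventually_le_atBot b] with a ha
    rw [← ofReal_integral_eq_lintegral_ofReal
      ((hG.integrableOn_Icc (a := a) (b := b)).mono_set Ioc_subset_Icc_self)
      ((ae_restrict_iff' measurableSet_Ioc).2 (Eventually.of_forall fun s hs =>
        hG0 s (hs.2.trans hb))), ← intervalIntegral.integral_of_le ha]
    apply ENNReal.ofReal_le_ofReal
    have h3 : ∫ s in a..b, K s ≤ I := by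
      rw [intervalIntegral.integral_of_le ha]
      exact setIntegral_mono_set hK (Eventually.of_forall hK0)
        (show Ioc a b ≤ Iic s₀ from fun s hs => hs.2.trans hb).eventuallyLE
    have h4 := h a b ha hb
    have h5 := mul_le_mul_of_nonneg_left h3 hc₂
    have h6 := mul_le_mul_of_nonneg_left (h4.trans (by gcongr : _ ≤ c₂ * I + P a + c₃ * N b))
      (inv_nonneg.2 hc₁.le)
    rw [inv_mul_cancel_left₀ hc₁.ne'] at h6
    linarith
  have hpt' : ∀ b ∈ Icc (s₀ - 1) s₀, ∫⁻ s in Iic (s₀ - 1), ENNReal.ofReal (G s)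
      ≤ ENNReal.ofReal (c₁⁻¹ * c₂) * (∫⁻ s in Iic s₀, ENNReal.ofReal (K s))
        + ENNReal.ofReal (c₁⁻¹ * c₃) * ENNReal.ofReal (N b) := by
    intro b hb
    refine (lintegral_mono_set (Iic_subset_Iic.2 hb.1)).trans ((hpt b hb.2).trans ?_)
    have h0 : 0 ≤ c₁⁻¹ := inv_nonneg.2 hc₁.le
    rw [ENNReal.ofReal_add (by positivity) (mul_nonneg (by positivity) (hN0 b)),
      ENNReal.ofReal_mul (by positivity), hI',
      ENNReal.ofReal_mul (q := N b) (by positivity)]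
  calc ∫⁻ s in Iic (s₀ - 1), ENNReal.ofReal (G s)
      = ∫⁻ _ in Icc (s₀ - 1) s₀, ∫⁻ s in Iic (s₀ - 1), ENNReal.ofReal (G s) := by simp
    _ ≤ ∫⁻ b in Icc (s₀ - 1) s₀,
        (ENNReal.ofReal (c₁⁻¹ * c₂) * (∫⁻ s in Iic s₀, ENNReal.ofReal (K s))
        + ENNReal.ofReal (c₁⁻¹ * c₃) * ENNReal.ofReal (N b)) :=
      setLIntegral_mono' measurableSet_Icc hpt'
    _ = _ := by
      rw [lintegral_add_left measurable_const,
        lintegral_const_mul _ hN.measurable.ennreal_ofReal]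
      simp

/-- Derivative of the red-shift energy `g (x⁻¹ ‖Y‖² - w ‖u‖²)`, where `Y = u' + iωu`. -/
lemma hasDerivAt_redshift_energy {x w g : ℝ → ℝ} {u Y : ℝ → ℂ} {x' w' g' ω s : ℝ} {h : ℂ}
    (hx : 0 < x s) (hxd : HasDerivAt x x' s) (hwd : HasDerivAt w w' s)
    (hgd : HasDerivAt g g' s)
    (hu : HasDerivAt u (Y s - Complex.I * (ω : ℂ) * u s) s)
    (hY : HasDerivAt Y (Complex.I * (ω : ℂ) * Y s + ((x s * w s : ℝ) : ℂ) * u s + h) s) :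
    HasDerivAt (fun t => g t * ((x t)⁻¹ * ‖Y t‖ ^ 2) - g t * w t * ‖u t‖ ^ 2)
      (g' * ((x s)⁻¹ * ‖Y s‖ ^ 2) - g s * x' / x s * ((x s)⁻¹ * ‖Y s‖ ^ 2)
        + 2 * g s * ((x s)⁻¹ * inner ℝ (Y s) h)
        - (g' * w s + g s * w') * ‖u s‖ ^ 2) s := by
  have hx0 := hx.ne'
  have h1 := (hgd.mul ((hxd.inv hx0).mul hY.norm_sq)).sub ((hgd.mul hwd).mul hu.norm_sq)
  refine h1.congr_deriv ?_
  simp only [Complex.inner, Pi.inv_apply, Pi.mul_apply]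
  simp only [Complex.add_re, Complex.mul_re, Complex.mul_im, Complex.add_im, Complex.conj_re,
    Complex.conj_im, Complex.I_re, Complex.I_im, Complex.ofReal_re, Complex.ofReal_im,
    Complex.sub_re, Complex.sub_im]
  field_simp
  ring

/-- Red-shift estimate for `u'' - (-ω² + x w) u = H`, where `x` decays exponentially at `-∞` and
`w` is comparable to `N`. -/
lemma redshift_lintegral_le {x x' w w' : ℝ → ℝ} {c₀ A a N δ s₀ ω : ℝ} {u H : ℝ → ℂ} {c : ℂ}
    (hc₀ : 0 < c₀) (ha : 0 < a) (hA : 0 ≤ A) (hN : 0 < N) (hδ : 0 < δ) (hs₀ : s₀ < 0)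
    (hx : ∀ s, 0 < x s) (hxd : ∀ s, HasDerivAt x (x' s) s)
    (hx' : ∀ s ≤ s₀, c₀ * x s ≤ x' s) (hx0 : Tendsto x atBot (nhds 0))
    (hwd : ∀ s, HasDerivAt w (w' s) s) (hw' : ∀ s ≤ s₀, -(A * N * x s) ≤ w' s)
    (hwl : ∀ s ≤ s₀, a * N ≤ w s) (hwu : ∀ s ≤ s₀, w s ≤ A * N)
    (hδ₁ : ∀ s ≤ s₀, δ * (1 - s) ^ (-1 - δ) ≤ c₀ / 4)
    (hδ₂ : ∀ s ≤ s₀, 2 * A * x s ≤ δ * a / 2 * (1 - s) ^ (-1 - δ))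
    (hH : Continuous H) (hu : ContDiff ℝ 2 u)
    (heq : ∀ s, deriv (deriv u) s - ((-ω ^ 2 + x s * w s : ℝ) : ℂ) * u s = H s)
    (hc₁ : Tendsto (fun s : ℝ => u s - c * Complex.exp (-Complex.I * (ω : ℂ) * (s : ℂ)))
      atBot (nhds 0))
    (hc₂ : Tendsto (fun s : ℝ => deriv u s
      + Complex.I * (ω : ℂ) * c * Complex.exp (-Complex.I * (ω : ℂ) * (s : ℂ))) atBot (nhds 0)) :
    ∫⁻ s in Iic (s₀ - 1),
        ENNReal.ofReal ((x s)⁻¹ * ‖deriv u s + Complex.I * (ω : ℂ) * u s‖ ^ 2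
          + N * (1 + |s|) ^ (-1 - δ) * ‖u s‖ ^ 2)
      ≤ ENNReal.ofReal ((min (c₀ / 2) (δ * a / 2))⁻¹ * (16 / c₀))
          * (∫⁻ s in Iic s₀, ENNReal.ofReal ((x s)⁻¹ * ‖H s‖ ^ 2))
        + ENNReal.ofReal ((min (c₀ / 2) (δ * a / 2))⁻¹ * (2 * A * N))
          * ∫⁻ s in Icc (s₀ - 1) s₀, ENNReal.ofReal (‖u s‖ ^ 2) := by
  set m := min (c₀ / 2) (δ * a / 2) with hm
  have hm0 : 0 < m := lt_min (by positivity) (by positivity)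
  have hxc : Continuous x := continuous_iff_continuousAt.2 fun s => (hxd s).continuousAt
  have hKc : Continuous fun s => (x s)⁻¹ * ‖H s‖ ^ 2 :=
    (hxc.inv₀ fun s => (hx s).ne').mul (hH.norm.pow 2)
  have hK0 : ∀ s, 0 ≤ (x s)⁻¹ * ‖H s‖ ^ 2 := fun s =>
    mul_nonneg (inv_nonneg.2 (hx s).le) (sq_nonneg _)
  by_cases hK : IntegrableOn (fun s => (x s)⁻¹ * ‖H s‖ ^ 2) (Iic s₀)
  swap
  · have htop : ∫⁻ s in Iic s₀, ENNReal.ofReal ((x s)⁻¹ * ‖H s‖ ^ 2) = ⊤ := by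
      by_contra hne
      exact hK ((lintegral_ofReal_ne_top_iff_integrable hKc.aestronglyMeasurable
        (Eventually.of_forall hK0)).1 hne)
    rw [htop, ENNReal.mul_top (by simpa using by positivity), top_add]
    exact le_top
  set Y : ℝ → ℂ := fun s => deriv u s + Complex.I * (ω : ℂ) * u s with hYdef
  have hud : ∀ s, HasDerivAt u (deriv u s) s := fun s =>
    (hu.differentiable (by norm_num)).differentiableAt.hasDerivAt
  have hu1 : ContDiff ℝ 1 (deriv u) := by
    have : ContDiff ℝ (1 + 1) u := by simpa [one_add_one_eq_two] using hu
    exact (contDiff_succ_iff_deriv.1 this).2.2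
  have hudd : ∀ s, HasDerivAt (deriv u) (deriv (deriv u) s) s := fun s =>
    (hu1.differentiable (by norm_num)).differentiableAt.hasDerivAt
  have hYd : ∀ s, HasDerivAt Y
      (Complex.I * (ω : ℂ) * Y s + ((x s * w s : ℝ) : ℂ) * u s + H s) s := by
    intro s
    refine ((hudd s).add ((hud s).const_mul (Complex.I * (ω : ℂ)))).congr_deriv ?_
    rw [← heq s, hYdef]
    push_cast
    linear_combination (-(ω : ℂ) ^ 2 * u s) * Complex.I_sq
  have hYc : Continuous Y := continuous_iff_continuousAt.2 fun s => (hYd s).continuousAt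
  have hexp : ∀ s : ℝ, ‖Complex.exp (-Complex.I * (ω : ℂ) * (s : ℂ))‖ = 1 := by
    intro s
    have : -Complex.I * (ω : ℂ) * (s : ℂ) = ((-ω * s : ℝ) : ℂ) * Complex.I := by
      push_cast; ring
    rw [this, Complex.norm_exp_ofReal_mul_I]
  have hY0 : Tendsto Y atBot (nhds 0) := by
    have h1 := hc₂.add (hc₁.const_mul (Complex.I * (ω : ℂ)))
    rw [mul_zero, add_zero] at h1
    refine h1.congr fun s => ?_
    simp only [hYdef]
    ring
  have hub : ∀ᶠ s in atBot, ‖u s‖ ≤ ‖c‖ + 1 := by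
    have h1 := (tendsto_zero_iff_norm_tendsto_zero.1 hc₁).eventually (gt_mem_nhds one_pos)
    filter_upwards [h1] with s hs
    have h2 := norm_add_le (u s - c * Complex.exp (-Complex.I * (ω : ℂ) * (s : ℂ)))
      (c * Complex.exp (-Complex.I * (ω : ℂ) * (s : ℂ)))
    rw [sub_add_cancel, norm_mul, hexp, mul_one] at h2
    linarith
  have hP : Tendsto (fun s => 2 * ((x s)⁻¹ * ‖Y s‖ ^ 2)) atBot (nhds 0) := by
    obtain ⟨b, hb⟩ := eventually_atBot.1 (hub.and (eventually_le_atBot s₀))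
    have hbs : b ≤ s₀ := (hb b le_rfl).2
    have hed : ∀ s : ℝ, HasDerivAt (fun t : ℝ => Complex.exp (-Complex.I * (ω : ℂ) * (t : ℂ)))
        (Complex.exp (-Complex.I * (ω : ℂ) * (s : ℂ)) * (-Complex.I * (ω : ℂ))) s := by
      intro s
      have h1 : HasDerivAt (fun t : ℝ => -Complex.I * (ω : ℂ) * (t : ℂ))
          (-Complex.I * (ω : ℂ)) s := by
        simpa using (Complex.ofRealCLM.hasDerivAt (x := s)).const_mul (-Complex.I * (ω : ℂ))
      exact h1.cexp
    have h1 := tendsto_inv_mul_norm_sq_atBot (x := x) (x' := x') (H := H) (c₀ := c₀) (b := b)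
      (B := A * N * (‖c‖ + 1))
      (Z := fun s => Complex.exp (-Complex.I * (ω : ℂ) * (s : ℂ)) * Y s)
      (Z' := fun s => Complex.exp (-Complex.I * (ω : ℂ) * (s : ℂ))
        * (((x s * w s : ℝ) : ℂ) * u s + H s))
      hc₀ (by positivity) hx hxd (fun s hs => hx' s (hs.trans hbs)) hx0 hH
      (hK.mono_set (Iic_subset_Iic.2 hbs))
      (fun s => ((hed s).mul (hYd s)).congr_deriv (by ring))
      (by
        intro s hs
        rw [norm_mul, hexp, one_mul]
        refine (norm_add_le _ _).trans (add_le_add_left ?_ _)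
        have hw0 : 0 ≤ w s := le_trans (by positivity) (hwl s (hs.trans hbs))
        have hxs := (hx s).le
        rw [norm_mul, Complex.norm_real, Real.norm_of_nonneg (mul_nonneg hxs hw0)]
        calc x s * w s * ‖u s‖ ≤ x s * (A * N) * (‖c‖ + 1) := by
              gcongr
              · exact hwu s (hs.trans hbs)
              · exact (hb s hs).1
          _ = _ := by ring)
      (by
        rw [tendsto_zero_iff_norm_tendsto_zero]
        simpa only [norm_mul, hexp, one_mul] using tendsto_zero_iff_norm_tendsto_zero.1 hY0)
    simpa only [norm_mul, hexp, one_mul, mul_zero] using h1.const_mul 2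
  set G : ℝ → ℝ := fun s => (x s)⁻¹ * ‖Y s‖ ^ 2 + N * (1 + |s|) ^ (-1 - δ) * ‖u s‖ ^ 2 with hGdef
  have hGc : Continuous G := by
    refine ((hxc.inv₀ fun s => (hx s).ne').mul (hYc.norm.pow 2)).add ?_
    refine (continuous_const.mul ?_).mul (hu.continuous.norm.pow 2)
    exact (continuous_const.add continuous_abs).rpow_const fun s =>
      Or.inl (add_pos_of_pos_of_nonneg one_pos (abs_nonneg s)).ne'
  have hG0 : ∀ s ≤ s₀, 0 ≤ G s := fun s _ => by have := hx s; simp only [hGdef]; positivity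
  refine lintegral_Iic_le_of_integral_le hGc hG0 hK hK0 hP (hu.continuous.norm.pow 2)
    (fun s => sq_nonneg _) hm0 (by positivity) (by positivity) ?_
  intro p b hpb hb
  set g : ℝ → ℝ := fun s => 1 + (1 - s) ^ (-δ) with hg
  have hgd : ∀ s < 1, HasDerivAt g (δ * (1 - s) ^ (-1 - δ)) s := by
    intro s hs
    have h1 : HasDerivAt (fun t : ℝ => 1 - t) (-1) s := by
      simpa using (hasDerivAt_id s).const_sub 1
    refine ((h1.rpow_const (p := -δ) (Or.inl (by linarith))).const_add 1).congr_deriv ?_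
    rw [show -1 - δ = -δ - 1 by ring]
    ring
  have hg1 : ∀ s ≤ s₀, 1 ≤ g s := fun s hs => by
    have : 0 ≤ (1 - s) ^ (-δ) := Real.rpow_nonneg (by linarith) _
    simp only [hg]; linarith
  have hg2 : ∀ s ≤ s₀, g s ≤ 2 := fun s hs => by
    have : (1 - s) ^ (-δ) ≤ 1 := Real.rpow_le_one_of_one_le_of_nonpos (by linarith) (by linarith)
    simp only [hg]; linarith
  have hF := fun s (hs : s ≤ s₀) => hasDerivAt_redshift_energy (u := u) (Y := Y) (ω := ω)
    (h := H s) (hx s) (hxd s) (hwd s) (hgd s (by linarith))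
    ((hud s).congr_deriv (by simp only [hYdef]; ring)) (hYd s)
  have hFTC := intervalIntegral.sub_le_integral_of_hasDeriv_right_of_le hpb
    (fun s hs => (hF s (hs.2.trans hb)).continuousAt.continuousWithinAt)
    (fun s hs => (hF s (hs.2.le.trans hb)).hasDerivWithinAt)
    (φ := fun s => 16 / c₀ * ((x s)⁻¹ * ‖H s‖ ^ 2) - m * G s)
    (((hKc.const_mul (16 / c₀)).sub (hGc.const_mul m)).integrableOn_Icc)
    (by
      intro s hs
      have hss : s ≤ s₀ := hs.2.le.trans hb
      have hxs := hx s
      have hXY : 0 ≤ (x s)⁻¹ * ‖Y s‖ ^ 2 := by positivity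
      have hU : 0 ≤ ‖u s‖ ^ 2 := by positivity
      have hD : 0 ≤ (1 - s) ^ (-1 - δ) := Real.rpow_nonneg (by linarith) _
      have e1 : δ * (1 - s) ^ (-1 - δ) * ((x s)⁻¹ * ‖Y s‖ ^ 2)
          ≤ c₀ / 4 * ((x s)⁻¹ * ‖Y s‖ ^ 2) := mul_le_mul_of_nonneg_right (hδ₁ s hss) hXY
      have e2 : c₀ * ((x s)⁻¹ * ‖Y s‖ ^ 2) ≤ g s * x' s / x s * ((x s)⁻¹ * ‖Y s‖ ^ 2) := by
        apply mul_le_mul_of_nonneg_right _ hXY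
        rw [le_div_iff₀ hxs]
        have h1 := hx' s hss
        have h2 : 0 ≤ x' s := le_trans (by positivity) h1
        nlinarith [hg1 s hss]
      have e3 : 2 * g s * ((x s)⁻¹ * inner ℝ (Y s) (H s))
          ≤ c₀ / 4 * ((x s)⁻¹ * ‖Y s‖ ^ 2) + 16 / c₀ * ((x s)⁻¹ * ‖H s‖ ^ 2) := by
        have h1 : 2 * g s * inner ℝ (Y s) (H s) ≤ 4 * (‖Y s‖ * ‖H s‖) := by
          have h2 := hg1 s hss
          calc 2 * g s * inner ℝ (Y s) (H s) ≤ 2 * g s * (‖Y s‖ * ‖H s‖) :=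
                mul_le_mul_of_nonneg_left (real_inner_le_norm _ _) (by linarith)
            _ ≤ 4 * (‖Y s‖ * ‖H s‖) :=
                mul_le_mul_of_nonneg_right (by linarith [hg2 s hss]) (by positivity)
        have h3 : 4 * (‖Y s‖ * ‖H s‖) ≤ c₀ / 4 * ‖Y s‖ ^ 2 + 16 / c₀ * ‖H s‖ ^ 2 := by
          have h4 : c₀ / 4 * ‖Y s‖ ^ 2 + 16 / c₀ * ‖H s‖ ^ 2 - 4 * (‖Y s‖ * ‖H s‖)
              = (c₀ * ‖Y s‖ - 8 * ‖H s‖) ^ 2 / (4 * c₀) := by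
            field_simp
            ring
          have h5 : 0 ≤ (c₀ * ‖Y s‖ - 8 * ‖H s‖) ^ 2 / (4 * c₀) := by positivity
          linarith
        have h6 := mul_le_mul_of_nonneg_left (h1.trans h3) (inv_nonneg.2 hxs.le)
        linarith
      have e4 : δ * a / 2 * (N * (1 - s) ^ (-1 - δ)) * ‖u s‖ ^ 2
          ≤ (δ * (1 - s) ^ (-1 - δ) * w s + g s * w' s) * ‖u s‖ ^ 2 := by
        apply mul_le_mul_of_nonneg_right _ hU
        have h1 : δ * (1 - s) ^ (-1 - δ) * (a * N) ≤ δ * (1 - s) ^ (-1 - δ) * w s :=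
          mul_le_mul_of_nonneg_left (hwl s hss) (by positivity)
        have h2 : -(2 * (A * N * x s)) ≤ g s * w' s := by
          have h3 : 0 ≤ A * N * x s := by positivity
          have h4 := hw' s hss
          have h5 := hg1 s hss
          have h6 := hg2 s hss
          nlinarith [mul_le_mul_of_nonneg_left h4 (by linarith : 0 ≤ g s)]
        have h7 := mul_le_mul_of_nonneg_left (hδ₂ s hss) hN.le
        linarith
      have e5 : m * ((x s)⁻¹ * ‖Y s‖ ^ 2) ≤ c₀ / 2 * ((x s)⁻¹ * ‖Y s‖ ^ 2) :=
        mul_le_mul_of_nonneg_right (min_le_left _ _) hXY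
      have e6 : m * (N * (1 - s) ^ (-1 - δ) * ‖u s‖ ^ 2)
          ≤ δ * a / 2 * (N * (1 - s) ^ (-1 - δ) * ‖u s‖ ^ 2) :=
        mul_le_mul_of_nonneg_right (min_le_right _ _) (by positivity)
      have e7 : G s = (x s)⁻¹ * ‖Y s‖ ^ 2 + N * (1 - s) ^ (-1 - δ) * ‖u s‖ ^ 2 := by
        simp only [hGdef]
        rw [abs_of_neg (by linarith), ← sub_eq_add_neg]
      rw [e7]
      linarith)
  rw [intervalIntegral.integral_sub ((hKc.const_mul _).intervalIntegrable _ _)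
    ((hGc.const_mul _).intervalIntegrable _ _), intervalIntegral.integral_const_mul,
    intervalIntegral.integral_const_mul] at hFTC
  have hps : p ≤ s₀ := hpb.trans hb
  have f1 : g p * ((x p)⁻¹ * ‖Y p‖ ^ 2) ≤ 2 * ((x p)⁻¹ * ‖Y p‖ ^ 2) :=
    mul_le_mul_of_nonneg_right (hg2 p hps) (by have := hx p; positivity)
  have f2 : 0 ≤ g p * w p * ‖u p‖ ^ 2 := by
    have h1 : 0 ≤ w p := le_trans (by positivity) (hwl p hps)
    have h2 := hg1 p hps
    positivity
  have f3 : 0 ≤ g b * ((x b)⁻¹ * ‖Y b‖ ^ 2) := by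
    have h1 := hx b
    have h2 := hg1 b hb
    positivity
  have f4 : g b * w b * ‖u b‖ ^ 2 ≤ 2 * A * N * ‖u b‖ ^ 2 := by
    apply mul_le_mul_of_nonneg_right _ (by positivity)
    have h1 : 0 ≤ w b := le_trans (by positivity) (hwl b hb)
    calc g b * w b ≤ 2 * (A * N) := by
          gcongr
          · exact hg2 b hb
          · exact hwu b hb
      _ = _ := by ring
  linarith

/-- The radius as a function of the tortoise-type coordinate is differentiable. -/
lemma hasDerivAt_radius {rm rp κ : ℝ} {rofs : ℝ → ℝ} (hκ : 0 < κ) (hmp : rm < rp)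
    (hr1 : ∀ s, rp < rofs s)
    (hr2 : ∀ s, rofs s + (2 * κ)⁻¹ * Real.log ((rofs s - rm) * (rofs s - rp)) = s) (s : ℝ) :
    HasDerivAt rofs (1 + (2 * κ)⁻¹ * ((rofs s - rp)⁻¹ + (rofs s - rm)⁻¹))⁻¹ s := by
  have hexpand : ∀ a b, rofs a ≤ rofs b → |rofs a - rofs b| ≤ |a - b| := by
    intro a b hab
    have ha := hr1 a
    have h1 : Real.log ((rofs a - rm) * (rofs a - rp))
        ≤ Real.log ((rofs b - rm) * (rofs b - rp)) := by
      apply Real.log_le_log (mul_pos (by linarith) (by linarith))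
      apply mul_le_mul <;> linarith
    have h2 := mul_le_mul_of_nonneg_left h1 (by positivity : 0 ≤ (2 * κ)⁻¹)
    have h3 := hr2 a
    have h4 := hr2 b
    rw [abs_sub_comm, abs_of_nonneg (by linarith), abs_sub_comm]
    exact le_trans (by linarith) (le_abs_self _)
  have hlip : LipschitzWith 1 rofs := by
    refine LipschitzWith.of_dist_le_mul fun a b => ?_
    simp only [NNReal.coe_one, one_mul, Real.dist_eq]
    rcases le_total (rofs a) (rofs b) with h | h
    · exact hexpand a b h
    · rw [abs_sub_comm, abs_sub_comm a]
      exact hexpand b a h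
  have hx : 0 < rofs s - rp := sub_pos.2 (hr1 s)
  have hy : 0 < rofs s - rm := by linarith
  refine HasDerivAt.of_local_left_inverse
    (f := fun r => r + (2 * κ)⁻¹ * Real.log ((r - rm) * (r - rp)))
    hlip.continuous.continuousAt ?_ (by positivity) (Eventually.of_forall hr2)
  have h1 : HasDerivAt (fun r => (r - rm) * (r - rp))
      (1 * (rofs s - rp) + (rofs s - rm) * 1) (rofs s) :=
    ((hasDerivAt_id _).sub_const rm).mul ((hasDerivAt_id _).sub_const rp)
  refine ((hasDerivAt_id _).add ((h1.log (mul_pos hy hx).ne').const_mul (2 * κ)⁻¹)).congr_deriv ?_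
  have := hx.ne'
  have := hy.ne'
  field_simp
  ring

/-- A function that is `C¹` on the positive half-line is bounded with its derivative on compact
intervals. -/
lemma exists_bound_and_deriv_bound {φ : ℝ → ℝ} (hφ : ContDiffOn ℝ 1 φ (Ioi 0)) {a b : ℝ}
    (ha : 0 < a) : ∃ P, 0 ≤ P ∧ ∀ r ∈ Icc a b, |φ r| ≤ P ∧ |deriv φ r| ≤ P := by
  have hsub : Icc a b ⊆ Ioi 0 := fun r hr => ha.trans_le hr.1
  obtain ⟨P₁, h₁⟩ := isCompact_Icc.exists_bound_of_continuousOn (hφ.continuousOn.mono hsub)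
  obtain ⟨P₂, h₂⟩ := isCompact_Icc.exists_bound_of_continuousOn
    ((hφ.continuousOn_deriv_of_isOpen isOpen_Ioi le_rfl).mono hsub)
  refine ⟨max 0 (max P₁ P₂), le_max_left _ _, fun r hr => ⟨?_, ?_⟩⟩
  · exact (h₁ r hr).trans ((le_max_left _ _).trans (le_max_right _ _))
  · exact (h₂ r hr).trans ((le_max_right _ _).trans (le_max_right _ _))

/-- An exponential dominates a power at `-∞`. -/
lemma eventually_const_mul_exp_le_rpow {κ A c p : ℝ} (hκ : 0 < κ) (hc : 0 < c) :
    ∀ᶠ s : ℝ in atBot, A * Real.exp (κ * s) ≤ c * (1 - s) ^ (-p) := by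
  have h1 : Tendsto (fun s : ℝ => 1 - s) atBot atTop :=
    tendsto_atTop_add_const_left _ 1 tendsto_neg_atBot_atTop
  have h2 := ((tendsto_rpow_mul_exp_neg_mul_atTop_nhds_zero p κ hκ).comp h1).const_mul
    (A * Real.exp κ)
  rw [mul_zero] at h2
  filter_upwards [h2.eventually (gt_mem_nhds hc), eventually_le_atBot 0] with s hs hs0
  have hpos : 0 < (1 - s) ^ p := Real.rpow_pos_of_pos (by linarith) _
  rw [Real.rpow_neg (by linarith), ← div_eq_mul_inv, le_div_iff₀ hpos]
  have h3 : Real.exp κ * Real.exp (-κ * (1 - s)) = Real.exp (κ * s) := by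
    rw [← Real.exp_add]
    congr 1
    ring
  simp only [Function.comp_apply] at hs
  rw [← h3]
  linarith

set_option maxHeartbeats 1000000 in
/-- Red-shift estimate near the event horizon (low frequencies ). -/
theorem statement4
    (M m E : ℝ) (hM : 0 < M) (hm : 0 < m) (hE : |E| < M)
    (rm rp κ : ℝ)
    (hrm : rm = M - Real.sqrt (M ^ 2 - E ^ 2))
    (hrp : rp = M + Real.sqrt (M ^ 2 - E ^ 2))
    (hκ : κ = (M * rp - E ^ 2) / rp ^ 3)
    (rofs : ℝ → ℝ)
    (hr1 : ∀ s : ℝ, rp < rofs s)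
    (hr2 : ∀ s : ℝ, rofs s + (2 * κ)⁻¹ * Real.log ((rofs s - rm) * (rofs s - rp)) = s) :
    ∀ δ : ℝ, δ ∈ Set.Ioo (0 : ℝ) 1 →
    ∃ s0star : ℝ, s0star < 0 ∧ ∃ C : ℝ, 0 < C ∧ ∃ L₀ : ℕ, ∀ L : ℕ, L₀ ≤ L →
    ∀ ω : ℝ, ω ^ 2 < m ^ 2 →
    ∀ s₀ : ℝ, s₀ ≤ s0star →
    ∀ H u : ℝ → ℂ, Continuous H → ContDiff ℝ 2 u →
    (∀ s : ℝ, deriv (deriv u) s - (Vpot M m E rofs ω L s : ℂ) * u s = H s) →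
    WeaklyOutgoing ω u →
    (∫⁻ s in Set.Iic (s₀ - 1),
        ENNReal.ofReal ((rofs s - rp)⁻¹ * ‖deriv u s + Complex.I * (ω : ℂ) * u s‖ ^ 2
          + (L : ℝ) ^ 2 * (1 + |s|) ^ (-1 - δ) * ‖u s‖ ^ 2))
      ≤ ENNReal.ofReal C *
        ((∫⁻ s in Set.Iic s₀, ENNReal.ofReal ((rofs s - rp)⁻¹ * ‖H s‖ ^ 2))
          + ENNReal.ofReal ((L : ℝ) ^ 2) *
            ∫⁻ s in Set.Icc (s₀ - 1) s₀, ENNReal.ofReal (‖u s‖ ^ 2)) := by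
  intro δ hδ
  have hE2 : E ^ 2 < M ^ 2 := sq_lt_sq' (by linarith [(abs_lt.1 hE).1]) (abs_lt.1 hE).2
  have hq : 0 < √(M ^ 2 - E ^ 2) := Real.sqrt_pos.2 (by linarith)
  have hqq : √(M ^ 2 - E ^ 2) ^ 2 = M ^ 2 - E ^ 2 := Real.sq_sqrt (by linarith)
  have hmp : rm < rp := by linarith
  have hMp : M < rp := by linarith
  have hrp0 : 0 < rp := hM.trans hMp
  have hMpE : E ^ 2 < M * rp := by nlinarith
  have hκ0 : 0 < κ := by rw [hκ]; exact div_pos (by linarith) (by positivity)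
  have hsum : rm + rp = 2 * M := by linarith
  have hprod : rm * rp = E ^ 2 := by rw [hrm, hrp]; linarith
  have hr0 : ∀ s, 0 < rofs s := fun s => hrp0.trans (hr1 s)
  have hrd := hasDerivAt_radius hκ0 hmp hr1 hr2
  set d := rp - rm with hd
  have hd0 : 0 < d := sub_pos.2 hmp
  have hx : ∀ s, 0 < rofs s - rp := fun s => sub_pos.2 (hr1 s)
  have hy : ∀ s, d < rofs s - rm := fun s => by linarith [hr1 s]
  have hxexp : ∀ s, rofs s - rp ≤ d⁻¹ * Real.exp (2 * κ * s) := by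
    intro s
    have hy0 := hd0.trans (hy s)
    have h1 : Real.log ((rofs s - rm) * (rofs s - rp)) = 2 * κ * (s - rofs s) := by
      have h2 : (2 * κ)⁻¹ * Real.log ((rofs s - rm) * (rofs s - rp)) = s - rofs s := by
        linarith [hr2 s]
      rw [← h2, mul_inv_cancel_left₀ (by positivity)]
    have h3 : (rofs s - rm) * (rofs s - rp) = Real.exp (2 * κ * (s - rofs s)) := by
      rw [← h1, Real.exp_log (mul_pos hy0 (hx s))]
    have h4 : d * (rofs s - rp) ≤ Real.exp (2 * κ * s) := by
      calc d * (rofs s - rp) ≤ (rofs s - rm) * (rofs s - rp) :=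
            mul_le_mul_of_nonneg_right (hy s).le (hx s).le
        _ = _ := h3
        _ ≤ _ := Real.exp_le_exp.2 (mul_le_mul_of_nonneg_left (by linarith [hr0 s]) (by positivity))
    rw [inv_mul_eq_div, le_div_iff₀ hd0]
    linarith
  have hexp0 : Tendsto (fun s : ℝ => d⁻¹ * Real.exp (2 * κ * s)) atBot (nhds 0) := by
    have h1 : Tendsto (fun s : ℝ => 2 * κ * s) atBot atBot :=
      tendsto_id.const_mul_atBot (by positivity)
    simpa using (Real.tendsto_exp_atBot.comp h1).const_mul d⁻¹
  have hx0 : Tendsto (fun s => rofs s - rp) atBot (nhds 0) :=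
    squeeze_zero (fun s => (hx s).le) hxexp hexp0
  set R : ℝ → ℝ := fun s => (1 + (2 * κ)⁻¹ * ((rofs s - rp)⁻¹ + (rofs s - rm)⁻¹))⁻¹ with hR
  have hR0 : ∀ s, 0 < R s := by
    intro s
    have h1 := hx s
    have h2 := hd0.trans (hy s)
    simp only [hR]
    positivity
  have hRu : ∀ s, R s ≤ 2 * κ * (rofs s - rp) := by
    intro s
    have h1 := hx s
    have h2 := hd0.trans (hy s)
    have h3 : 2 * κ * (rofs s - rp) = ((2 * κ)⁻¹ * (rofs s - rp)⁻¹)⁻¹ := by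
      rw [mul_inv, inv_inv, inv_inv]
    rw [h3]
    apply inv_anti₀ (by positivity)
    have h4 : 0 ≤ (2 * κ)⁻¹ * (rofs s - rm)⁻¹ := by positivity
    linarith
  set c₀ := (1 + (2 * κ)⁻¹ * (1 + d⁻¹))⁻¹ with hc₀
  have hc₀0 : 0 < c₀ := by positivity
  have hRl : ∀ s, rofs s - rp ≤ 1 → c₀ * (rofs s - rp) ≤ R s := by
    intro s hs
    have h1 := hx s
    have h2 := hd0.trans (hy s)
    have h3 : c₀ * (rofs s - rp) = ((1 + (2 * κ)⁻¹ * (1 + d⁻¹)) * (rofs s - rp)⁻¹)⁻¹ := by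
      rw [mul_inv, inv_inv]
    rw [h3]
    apply inv_anti₀ (by positivity)
    have h4 : 1 ≤ (rofs s - rp)⁻¹ := (one_le_inv₀ h1).2 hs
    have h5 : (rofs s - rm)⁻¹ ≤ d⁻¹ := inv_anti₀ hd0 (hy s).le
    have h6 : d⁻¹ ≤ d⁻¹ * (rofs s - rp)⁻¹ := le_mul_of_one_le_right (by positivity) h4
    have h7 : (2 * κ)⁻¹ * (rofs s - rm)⁻¹ ≤ (2 * κ)⁻¹ * (d⁻¹ * (rofs s - rp)⁻¹) :=
      mul_le_mul_of_nonneg_left (h5.trans h6) (by positivity)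
    linarith
  set φ : ℝ → ℝ := fun r => (r - rm) / r ^ 4 with hφ
  set ψ : ℝ → ℝ := fun r => (r - rm) / r ^ 2 * (m ^ 2 + (2 * M * r - 2 * E ^ 2) / r ^ 4) with hψ
  have hdiv : ∀ (f : ℝ → ℝ) (n : ℕ), ContDiff ℝ 1 f →
      ContDiffOn ℝ 1 (fun r => f r / r ^ n) (Ioi 0) := fun f n hf =>
    hf.contDiffOn.div (by fun_prop) fun r hr => pow_ne_zero _ (ne_of_gt (mem_Ioi.1 hr))
  have hφc : ContDiffOn ℝ 1 φ (Ioi 0) := hdiv (fun r => r - rm) 4 (by fun_prop)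
  have hψc : ContDiffOn ℝ 1 ψ (Ioi 0) :=
    (hdiv (fun r => r - rm) 2 (by fun_prop)).mul
      (contDiffOn_const.add (hdiv (fun r => 2 * M * r - 2 * E ^ 2) 4 (by fun_prop)))
  obtain ⟨P, hP0, hP⟩ := exists_bound_and_deriv_bound hφc (a := rp) (b := rp + 1) hrp0
  obtain ⟨Q, hQ0, hQ⟩ := exists_bound_and_deriv_bound hψc (a := rp) (b := rp + 1) hrp0
  have hφd : ∀ s, HasDerivAt φ (deriv φ (rofs s)) (rofs s) := fun s =>
    ((hφc.differentiableOn (by norm_num)).differentiableAt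
      (Ioi_mem_nhds (hr0 s))).hasDerivAt
  have hψd : ∀ s, HasDerivAt ψ (deriv ψ (rofs s)) (rofs s) := fun s =>
    ((hψc.differentiableOn (by norm_num)).differentiableAt
      (Ioi_mem_nhds (hr0 s))).hasDerivAt
  set a := d / (rp + 1) ^ 4 with ha
  have ha0 : 0 < a := by positivity
  have hφl : ∀ s, rofs s - rp ≤ 1 → a ≤ φ (rofs s) := by
    intro s hs
    have h1 := hr0 s
    have h2 := hy s
    simp only [ha, hφ]
    exact div_le_div₀ (by linarith) h2.le (by positivity)
      (pow_le_pow_left₀ h1.le (by linarith) 4)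
  have hψ0 : ∀ s, 0 ≤ ψ (rofs s) := by
    intro s
    have h1 := hr0 s
    have h2 := hd0.trans (hy s)
    have h3 : 0 ≤ 2 * M * rofs s - 2 * E ^ 2 := by nlinarith [hr1 s]
    simp only [hψ]
    positivity
  set A := (2 * P + Q) * (1 + 2 * κ) with hA
  have hA0 : 0 ≤ A := by positivity
  have hAPQ : 2 * P + Q ≤ A := by
    have : 0 ≤ (2 * P + Q) * (2 * κ) := by positivity
    linarith
  have hAκ : (2 * P + Q) * (2 * κ) ≤ A := by linarith
  have hcond : ∀ᶠ s : ℝ in atBot, s ≤ -1 ∧ rofs s - rp ≤ 1 ∧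
      δ * (1 - s) ^ (-1 - δ) ≤ c₀ / 4 ∧
      2 * A * (rofs s - rp) ≤ δ * a / 2 * (1 - s) ^ (-1 - δ) := by
    have hδ0 := hδ.1
    have hp : Tendsto (fun s : ℝ => δ * (1 - s) ^ (-1 - δ)) atBot (nhds 0) := by
      have h1 : Tendsto (fun s : ℝ => 1 - s) atBot atTop :=
        tendsto_atTop_add_const_left _ 1 tendsto_neg_atBot_atTop
      have h2 := ((tendsto_rpow_neg_atTop (y := 1 + δ) (by linarith)).comp h1).const_mul δ
      rw [mul_zero] at h2
      refine h2.congr fun s => ?_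
      rw [Function.comp_apply, neg_add']
    filter_upwards [eventually_le_atBot (-1), hx0.eventually (gt_mem_nhds one_pos),
      hp.eventually (gt_mem_nhds (by positivity : 0 < c₀ / 4)),
      eventually_const_mul_exp_le_rpow (κ := 2 * κ) (A := 2 * A * d⁻¹) (c := δ * a / 2)
        (p := 1 + δ) (by positivity) (by positivity)] with s h1 h2 h3 h4
    refine ⟨h1, h2.le, h3.le, ?_⟩
    rw [neg_add'] at h4
    have := mul_le_mul_of_nonneg_left (hxexp s) (by positivity : 0 ≤ 2 * A)
    linarith
  obtain ⟨σ, hσ⟩ := eventually_atBot.1 hcond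
  set μ := min (c₀ / 2) (δ * a / 2) with hμ
  have hμ0 : 0 < μ := lt_min (by positivity) (by have := hδ.1; positivity)
  refine ⟨σ, by linarith [(hσ σ le_rfl).1], μ⁻¹ * (16 / c₀ + 2 * A), by positivity, 1, ?_⟩
  intro L hL ω _ s₀ hs₀ H u hH hu heq hout
  obtain ⟨⟨c, hc₁, hc₂⟩, -⟩ := hout
  have hL1 : (1 : ℝ) ≤ L := by exact_mod_cast hL
  set ℓ := (L : ℝ) * ((L : ℝ) + 1) with hℓ
  have hℓl : (L : ℝ) ^ 2 ≤ ℓ := by nlinarith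
  have hℓu : ℓ ≤ 2 * (L : ℝ) ^ 2 := by nlinarith
  have hN1 : 1 ≤ (L : ℝ) ^ 2 := one_le_pow₀ hL1
  have hmem : ∀ s, rofs s - rp ≤ 1 → rofs s ∈ Icc rp (rp + 1) := fun s hs =>
    ⟨(hr1 s).le, by linarith⟩
  have hcomb : ∀ p q : ℝ, |p| ≤ P → |q| ≤ Q → |ℓ * p + q| ≤ (2 * P + Q) * (L : ℝ) ^ 2 := by
    intro p q hp hq
    calc |ℓ * p + q| ≤ |ℓ * p| + |q| := abs_add_le _ _
      _ = ℓ * |p| + |q| := by rw [abs_mul, abs_of_nonneg (by linarith : 0 ≤ ℓ)]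
      _ ≤ 2 * (L : ℝ) ^ 2 * P + Q * (L : ℝ) ^ 2 := by
          gcongr
          nlinarith
      _ = _ := by ring
  have main := redshift_lintegral_le (x := fun s => rofs s - rp) (x' := R)
    (w := fun s => ℓ * φ (rofs s) + ψ (rofs s))
    (w' := fun s => (ℓ * deriv φ (rofs s) + deriv ψ (rofs s)) * R s)
    (c₀ := c₀) (A := A) (a := a) (N := (L : ℝ) ^ 2) (δ := δ) (s₀ := s₀) (ω := ω) (u := u)
    (H := H) (c := c) hc₀0 ha0 hA0 (by linarith) hδ.1 (by linarith [(hσ s₀ hs₀).1]) hx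
    (fun s => (hrd s).sub_const rp) (fun s hs => hRl s (hσ s (hs.trans hs₀)).2.1) hx0
    (fun s => ((((hφd s).comp s (hrd s)).const_mul ℓ).add
      ((hψd s).comp s (hrd s))).congr_deriv (by simp only [hR]; ring))
    (by
      intro s hs
      have hm := hmem s (hσ s (hs.trans hs₀)).2.1
      have h1 := hcomb _ _ (hP _ hm).2 (hQ _ hm).2
      have h2 : |(ℓ * deriv φ (rofs s) + deriv ψ (rofs s)) * R s|
          ≤ A * (L : ℝ) ^ 2 * (rofs s - rp) := by
        have h3 := hx s
        rw [abs_mul, abs_of_pos (hR0 s)]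
        calc _ ≤ (2 * P + Q) * (L : ℝ) ^ 2 * (2 * κ * (rofs s - rp)) :=
              mul_le_mul h1 (hRu s) (hR0 s).le (by positivity)
          _ = (2 * P + Q) * (2 * κ) * ((L : ℝ) ^ 2 * (rofs s - rp)) := by ring
          _ ≤ A * ((L : ℝ) ^ 2 * (rofs s - rp)) :=
              mul_le_mul_of_nonneg_right hAκ (by positivity)
          _ = _ := by ring
      exact (abs_le.1 h2).1)
    (by
      intro s hs
      have h1 := hφl s (hσ s (hs.trans hs₀)).2.1
      have h2 : (L : ℝ) ^ 2 * a ≤ ℓ * φ (rofs s) :=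
        mul_le_mul hℓl h1 ha0.le (by linarith)
      have h3 := hψ0 s
      linarith)
    (by
      intro s hs
      have hm := hmem s (hσ s (hs.trans hs₀)).2.1
      have h1 := (abs_le.1 (hcomb _ _ (hP _ hm).1 (hQ _ hm).1)).2
      exact h1.trans (mul_le_mul_of_nonneg_right hAPQ (by positivity)))
    (fun s hs => (hσ s (hs.trans hs₀)).2.2.1) (fun s hs => (hσ s (hs.trans hs₀)).2.2.2) hH hu
    (by
      intro s
      rw [← heq s]
      congr 3
      have h1 := (hr0 s).ne'
      simp only [Vpot, hφ, hψ]
      have h2 : 1 - 2 * M / rofs s + E ^ 2 / rofs s ^ 2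
          = (rofs s - rp) * ((rofs s - rm) / rofs s ^ 2) := by
        rw [← hsum, ← hprod]
        field_simp
        ring
      rw [h2]
      field_simp
      ring) hc₁ hc₂
  refine main.trans ?_
  rw [mul_add, ← mul_assoc (ENNReal.ofReal _) (ENNReal.ofReal _), ← ENNReal.ofReal_mul
    (by positivity)]
  have hμi : 0 ≤ μ⁻¹ := inv_nonneg.2 hμ0.le
  have hc₀i : 0 ≤ 16 / c₀ := by positivity
  refine add_le_add (mul_le_mul_left (ENNReal.ofReal_le_ofReal ?_) _)
    (mul_le_mul_left (ENNReal.ofReal_le_ofReal ?_) _)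
  · exact mul_le_mul_of_nonneg_left (by linarith) hμi
  · rw [← mul_assoc]
    exact mul_le_mul_of_nonneg_right
      (mul_le_mul_of_nonneg_left (by linarith) hμi) (by positivity)
end

section
/- Assume the Reissner–Nordström radial setup stated in the context. For every δ ∈ (0, 1) there exist A₀ > 0 and C > 0, depending only on δ, M, 𝐞, m, such that for all sufficiently large integers L, all ω ∈ [0, m) with m² − ω² ≥ A₀/L², and every weakly outgoing C² solution u of u'' − V(ω, L, ·)·u = H, one has ∫_{−∞}^{∞} [ (r/(r − r₊))·|u' + iωu|² + (max(0, −s)^{1+δ} + 1)⁻¹·(|u'|² + |u|²) ] ds ≤ C·L⁴·∫_{−∞}^{∞} (r/(r − r₊))·|H|² ds. -/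
open MeasureTheory Filter Set

/-- The inverse of a tortoise-type coordinate is differentiable, with derivative comparable to
`(r - rp) / r`. -/
lemma exists_hasDerivAt_radius {rm rp b : ℝ} (hrp : 0 < rp) (hlt : rm < rp) (hb : 0 < b)
    {r : ℝ → ℝ} (hr1 : ∀ s, rp < r s)
    (hr2 : ∀ s, r s + b * Real.log ((r s - rm) * (r s - rp)) = s) :
    ∃ φ : ℝ → ℝ, ∃ c₁ C₁ : ℝ, 0 < c₁ ∧ 0 < C₁ ∧ ∀ s, HasDerivAt r (φ s) s ∧
      c₁ * (1 - rp * (r s)⁻¹) ≤ φ s ∧ φ s ≤ C₁ * (1 - rp * (r s)⁻¹) := by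
  set S : ℝ → ℝ := fun x => x + b * Real.log ((x - rm) * (x - rp)) with hS
  have hSstrict : ∀ x y, rp < x → x < y → S x < S y := by
    intro x y hx hxy
    have h1 : 0 < (x - rm) * (x - rp) := mul_pos (by linarith) (by linarith)
    have h2 : (x - rm) * (x - rp) ≤ (y - rm) * (y - rp) := by
      apply mul_le_mul <;> linarith
    have h3 := mul_le_mul_of_nonneg_left (Real.log_le_log h1 h2) hb.le
    simp only [hS]
    linarith
  have hSmono : ∀ x y, rp < x → x ≤ y → S x ≤ S y := fun x y hx hxy =>
    hxy.eq_or_lt.elim (fun h => h ▸ le_rfl) fun h => (hSstrict x y hx h).le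
  have hmono : StrictMono r := by
    intro s t hst
    by_contra! h
    have := hSmono _ _ (hr1 t) h
    simp only [hS, hr2] at this
    linarith
  have hinv : ∀ x, rp < x → r (S x) = x := by
    intro x hx
    rcases lt_trichotomy (r (S x)) x with h | h | h
    · have := hSstrict _ _ (hr1 _) h
      simp only [hS, hr2] at this
      exact absurd this (lt_irrefl _)
    · exact h
    · have := hSstrict _ _ hx h
      simp only [hS, hr2] at this
      exact absurd this (lt_irrefl _)
  have hcont : ∀ s, ContinuousAt r s := by
    intro s
    refine (hmono.strictMonoOn Set.univ).continuousAt_of_image_mem_nhds Filter.univ_mem ?_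
    refine Filter.mem_of_superset (Ioi_mem_nhds (hr1 s)) ?_
    intro x hx
    exact ⟨S x, trivial, hinv x hx⟩
  have hSderiv : ∀ x, rp < x →
      HasDerivAt S (1 + b * (1 / (x - rm) + 1 / (x - rp))) x := by
    intro x hx
    have h1 : x - rm ≠ 0 := by linarith
    have h2 : x - rp ≠ 0 := by linarith
    have h3 : HasDerivAt (fun x : ℝ => (x - rm) * (x - rp))
        (1 * (x - rp) + (x - rm) * 1) x :=
      ((hasDerivAt_id x).sub_const rm).mul ((hasDerivAt_id x).sub_const rp)
    refine ((hasDerivAt_id x).add ((h3.log (mul_ne_zero h1 h2)).const_mul b)).congr_deriv ?_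
    field_simp
  refine ⟨fun s => (1 + b * (1 / (r s - rm) + 1 / (r s - rp)))⁻¹,
    min 1 (rp / (2 * b)), max 1 (rp / b), by positivity, by positivity, fun s => ?_⟩
  have hx : 0 < r s - rp := by linarith [hr1 s]
  have hy : 0 < r s - rm := by linarith [hr1 s]
  have hr : 0 < r s := by linarith [hr1 s]
  have hpos : 0 < 1 + b * (1 / (r s - rm) + 1 / (r s - rp)) := by positivity
  refine ⟨HasDerivAt.of_local_left_inverse (hcont s) (hSderiv _ (hr1 s)) hpos.ne'
    (Filter.Eventually.of_forall hr2), ?_, ?_⟩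
  · rw [le_inv_comm₀ (mul_pos (by positivity) _) hpos]
    · have h1 : 1 / (r s - rm) ≤ 1 / (r s - rp) := one_div_le_one_div_of_le hx (by linarith)
      have h2 : 1 + b * (1 / (r s - rm) + 1 / (r s - rp)) ≤ 1 + b * (2 / (r s - rp)) := by
        have : (2 : ℝ) / (r s - rp) = 1 / (r s - rp) + 1 / (r s - rp) := by ring
        rw [this]
        gcongr
      refine h2.trans ?_
      rw [← one_div, le_div_iff₀ (mul_pos (by positivity) _)]
      · have e : (1 - rp * (r s)⁻¹) = (r s - rp) / r s := by field_simp
        rw [e, show (1 + b * (2 / (r s - rp))) * (min 1 (rp / (2 * b)) * ((r s - rp) / r s))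
          = (min 1 (rp / (2 * b)) * (r s - rp) + min 1 (rp / (2 * b)) * (2 * b)) / r s by
            field_simp, div_le_one hr]
        have a1 : min 1 (rp / (2 * b)) * (r s - rp) ≤ 1 * (r s - rp) := by
          gcongr; exact min_le_left _ _
        have a2 : min 1 (rp / (2 * b)) * (2 * b) ≤ rp := by
          rw [← le_div_iff₀ (by positivity)]; exact min_le_right _ _
        linarith
      · have e : (1 - rp * (r s)⁻¹) = (r s - rp) / r s := by field_simp
        rw [e]; positivity
    · have e : (1 - rp * (r s)⁻¹) = (r s - rp) / r s := by field_simp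
      rw [e]; positivity
  · have e : (1 - rp * (r s)⁻¹) = (r s - rp) / r s := by field_simp
    rw [e, inv_le_comm₀ hpos (by positivity)]
    have h2 : 1 + b * (1 / (r s - rp)) ≤ 1 + b * (1 / (r s - rm) + 1 / (r s - rp)) := by
      have : (0 : ℝ) ≤ 1 / (r s - rm) := by positivity
      gcongr
      linarith
    refine le_trans ?_ h2
    rw [← one_div, div_le_iff₀ (by positivity),
      show (1 + b * (1 / (r s - rp))) * (max 1 (rp / b) * ((r s - rp) / r s))
        = (max 1 (rp / b) * (r s - rp) + max 1 (rp / b) * b) / r s by field_simp,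
      one_le_div hr]
    have a1 : 1 * (r s - rp) ≤ max 1 (rp / b) * (r s - rp) := by
      gcongr; exact le_max_left _ _
    have a2 : rp ≤ max 1 (rp / b) * b := by
      rw [← div_le_iff₀ hb]; exact le_max_right _ _
    linarith

/-- If `J' ≤ Q - P` on the line, with `J` asymptotically nonpositive at `-∞` and asymptotically
nonnegative at `+∞`, then the integral of `P` is at most that of `Q`. -/
lemma lintegral_le_lintegral_of_hasDerivAt {J J' P Q : ℝ → ℝ}
    (hJ : ∀ s, HasDerivAt J (J' s) s) (hP : Continuous P) (hQ : Continuous Q)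
    (hP0 : ∀ s, 0 ≤ P s) (hQ0 : ∀ s, 0 ≤ Q s) (h : ∀ s, J' s ≤ Q s - P s)
    (hbot : ∀ η > 0, ∀ᶠ s in Filter.atBot, J s ≤ η)
    (htop : ∀ η > 0, ∀ᶠ s in Filter.atTop, -η ≤ J s) :
    ∫⁻ s, ENNReal.ofReal (P s) ≤ ∫⁻ s, ENNReal.ofReal (Q s) := by
  have hcov : AECover volume Filter.atTop (fun n : ℕ => Set.Ioc (-(n : ℝ)) (n : ℝ)) :=
    aecover_Ioc (tendsto_neg_atTop_atBot.comp tendsto_natCast_atTop_atTop)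
      tendsto_natCast_atTop_atTop
  have key := hcov.lintegral_tendsto_of_countably_generated
    (f := fun s => ENNReal.ofReal (P s)) (hP.measurable.ennreal_ofReal.aemeasurable)
  refine ENNReal.le_of_forall_pos_le_add fun η hη _ => ?_
  have hη2 : (0 : ℝ) < η / 2 := by positivity
  refine le_of_tendsto key ?_
  have e1 : ∀ᶠ n : ℕ in Filter.atTop, J (-(n : ℝ)) ≤ η / 2 :=
    (tendsto_neg_atTop_atBot.comp tendsto_natCast_atTop_atTop).eventually (hbot _ hη2)
  have e2 : ∀ᶠ n : ℕ in Filter.atTop, -((η : ℝ) / 2) ≤ J n :=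
    tendsto_natCast_atTop_atTop.eventually (htop _ hη2)
  filter_upwards [e1, e2] with n h1 h2
  have hn : -(n : ℝ) ≤ n := by linarith [(Nat.cast_nonneg n : (0 : ℝ) ≤ n)]
  have hI := intervalIntegral.sub_le_integral_of_hasDeriv_right_of_le (g := J) (g' := J')
    (φ := fun s => Q s - P s) hn (fun s _ => (hJ s).continuousAt.continuousWithinAt)
    (fun s _ => (hJ s).hasDerivWithinAt) (hQ.sub hP).continuousOn.integrableOn_Icc
    (fun s _ => h s)
  rw [intervalIntegral.integral_sub (hQ.intervalIntegrable _ _) (hP.intervalIntegrable _ _),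
    intervalIntegral.integral_of_le hn, intervalIntegral.integral_of_le hn] at hI
  have hPi : IntegrableOn P (Set.Ioc (-(n : ℝ)) n) :=
    hP.continuousOn.integrableOn_Icc.mono_set Set.Ioc_subset_Icc_self
  have hQi : IntegrableOn Q (Set.Ioc (-(n : ℝ)) n) :=
    hQ.continuousOn.integrableOn_Icc.mono_set Set.Ioc_subset_Icc_self
  calc ∫⁻ s in Set.Ioc (-(n : ℝ)) n, ENNReal.ofReal (P s)
      = ENNReal.ofReal (∫ s in Set.Ioc (-(n : ℝ)) n, P s) :=
        (ofReal_integral_eq_lintegral_ofReal hPi (Filter.Eventually.of_forall hP0)).symm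
    _ ≤ ENNReal.ofReal ((∫ s in Set.Ioc (-(n : ℝ)) n, Q s) + η) :=
        ENNReal.ofReal_le_ofReal (by linarith)
    _ ≤ ENNReal.ofReal (∫ s in Set.Ioc (-(n : ℝ)) n, Q s) + ENNReal.ofReal η :=
        ENNReal.ofReal_add_le
    _ = (∫⁻ s in Set.Ioc (-(n : ℝ)) n, ENNReal.ofReal (Q s)) + η := by
        rw [ofReal_integral_eq_lintegral_ofReal hQi (Filter.Eventually.of_forall hQ0),
          ENNReal.ofReal_coe_nnreal]
    _ ≤ (∫⁻ s, ENNReal.ofReal (Q s)) + η := by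
        gcongr
        exact Measure.restrict_le_self

/-- Lower bound for the zeroth order coefficient of the combined redshift and Lagrangian
current. -/
lemma zeroth_order_coeff_lower {rp c₁ C₁ g₀ γ K A₀ m M p φ G q l Λ : ℝ}
    (hrp : 0 < rp) (hc₁ : 0 < c₁) (hC₁ : 0 < C₁) (hg₀ : 0 < g₀) (hM : 0 < M)
    (hγ : γ = g₀ / 96) (hK : K = 16 * C₁ / (rp * γ)) (hA₀ : A₀ = 2 * M ^ 2 * m ^ 4 / γ)
    (hp : 0 < p) (hq : q = 1 - rp * p) (hq0 : 0 < q) (hφ1 : c₁ * q ≤ φ) (hφ2 : φ ≤ C₁ * q)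
    (hG1 : g₀ ≤ G) (hG2 : G ≤ 1) (hΛ0 : 0 < Λ) (hΛl : Λ ≤ l)
    (hΛ1 : K * (2 * M * m ^ 2 / rp + 2 * C₁ ^ 2 / rp ^ 2) ≤ c₁ * g₀ / (16 * rp ^ 3) * Λ)
    (hΛ2 : 2 * C₁ ^ 2 ≤ γ * Λ) :
    K * A₀ / 2 * q ^ 2 / Λ ≤ φ * p ^ 3 * G * l * (1 - 16 * q)
      + K * q ^ 2 * (A₀ / Λ - 2 * M * m ^ 2 * p + G * q * l * p ^ 2)
      - 2 * K * rp ^ 2 * C₁ ^ 2 * q ^ 2 * p ^ 4 := by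
  have hγ0 : 0 < γ := by rw [hγ]; positivity
  have hK0 : 0 < K := by rw [hK]; positivity
  have hA0 : 0 ≤ A₀ := by rw [hA₀]; positivity
  have hG0 : 0 < G := hg₀.trans_le hG1
  have hl0 : 0 < l := hΛ0.trans_le hΛl
  have hφ0 : 0 < φ := lt_of_lt_of_le (by positivity) hφ1
  have hq1 : q < 1 := by rw [hq]; nlinarith [mul_pos hrp hp]
  have hprp : rp * p < 1 := by linarith
  rcases le_total q (1 / 32) with h | h
  · have hp1 : 1 / (2 * rp) ≤ p := by
      rw [div_le_iff₀ (by positivity)]; nlinarith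
    have hp2 : p ≤ 1 / rp := by
      rw [le_div_iff₀ hrp]; linarith
    have e1 : c₁ * g₀ / (16 * rp ^ 3) * Λ * q ≤ φ * p ^ 3 * G * l * (1 - 16 * q) := by
      calc c₁ * g₀ / (16 * rp ^ 3) * Λ * q
          = (c₁ * q) * (1 / (2 * rp)) ^ 3 * g₀ * Λ * (1 / 2) := by field_simp; norm_num
        _ ≤ φ * p ^ 3 * G * l * (1 - 16 * q) := by
          gcongr
          linarith
    have e2 : q ^ 2 ≤ q := by nlinarith
    have e3 : K * q ^ 2 * (2 * M * m ^ 2 * p) ≤ K * q * (2 * M * m ^ 2 * (1 / rp)) := by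
      gcongr
    have e4 : 2 * K * rp ^ 2 * C₁ ^ 2 * q ^ 2 * p ^ 4
        ≤ 2 * K * rp ^ 2 * C₁ ^ 2 * q * (1 / rp) ^ 4 := by
      gcongr
    have e5 : 2 * K * rp ^ 2 * C₁ ^ 2 * q * (1 / rp) ^ 4 + K * q * (2 * M * m ^ 2 * (1 / rp))
        = K * (2 * M * m ^ 2 / rp + 2 * C₁ ^ 2 / rp ^ 2) * q := by
      field_simp
      ring
    have e6 := mul_le_mul_of_nonneg_right hΛ1 hq0.le
    have e7 : 0 ≤ K * q ^ 2 * (G * q * l * p ^ 2) := by positivity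
    have e8 : K * A₀ / 2 * q ^ 2 / Λ ≤ K * q ^ 2 * (A₀ / Λ) := by
      have : 0 ≤ K * q ^ 2 * (A₀ / Λ) := by positivity
      have e : K * A₀ / 2 * q ^ 2 / Λ = K * q ^ 2 * (A₀ / Λ) / 2 := by ring
      rw [e]; linarith
    linarith
  · have f1 : 3 * γ ≤ G * q := by
      rw [hγ]
      nlinarith [mul_le_mul hG1 h (by norm_num) hG0.le]
    have f2 : 3 * γ * l * p ^ 2 ≤ G * q * l * p ^ 2 := by gcongr
    have f3 : -(16 * C₁ * (1 / rp) * q ^ 2 * l * p ^ 2) ≤ φ * p ^ 3 * G * l * (1 - 16 * q) := by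
      have g1 : φ * G ≤ C₁ * q := (mul_le_of_le_one_right hφ0.le hG2).trans hφ2
      have hp2 : p ≤ 1 / rp := by
        rw [le_div_iff₀ hrp]; linarith
      have g2 : φ * p ^ 3 * G * l * (16 * q) ≤ (C₁ * q) * (p ^ 2 * (1 / rp)) * l * (16 * q) := by
        calc φ * p ^ 3 * G * l * (16 * q) = (φ * G) * (p ^ 2 * p) * l * (16 * q) := by ring
          _ ≤ _ := by gcongr
      have g3 : 0 ≤ φ * p ^ 3 * G * l := by positivity
      linarith
    have f4 : K * q ^ 2 * (γ * l * p ^ 2) = 16 * C₁ * (1 / rp) * q ^ 2 * l * p ^ 2 := by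
      rw [hK]; field_simp
    have f5 : 2 * M * m ^ 2 * p ≤ A₀ / Λ / 2 + γ * l * p ^ 2 := by
      have g1 : γ * Λ * p ^ 2 ≤ γ * l * p ^ 2 := by gcongr
      have g2 : A₀ / Λ / 2 + γ * Λ * p ^ 2 - 2 * M * m ^ 2 * p
          = (M * m ^ 2 - γ * Λ * p) ^ 2 / (γ * Λ) := by
        rw [hA₀]; field_simp; ring
      have g3 : 0 ≤ (M * m ^ 2 - γ * Λ * p) ^ 2 / (γ * Λ) := by positivity
      linarith
    have f6' : 2 * C₁ ^ 2 ≤ γ * l := hΛ2.trans (by gcongr)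
    have f6 : 2 * rp ^ 2 * C₁ ^ 2 * p ^ 4 ≤ γ * l * p ^ 2 := by
      calc 2 * rp ^ 2 * C₁ ^ 2 * p ^ 4 = (rp * p) ^ 2 * (2 * C₁ ^ 2) * p ^ 2 := by ring
        _ ≤ 1 ^ 2 * (γ * l) * p ^ 2 := by
          gcongr
        _ = γ * l * p ^ 2 := by ring
    have hKq : 0 < K * q ^ 2 := by positivity
    have f7 : 0 ≤ K * q ^ 2 * (A₀ / Λ / 2 - 2 * M * m ^ 2 * p + G * q * l * p ^ 2
        - γ * l * p ^ 2 - 2 * rp ^ 2 * C₁ ^ 2 * p ^ 4) :=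
      mul_nonneg hKq.le (by linarith)
    have e : K * A₀ / 2 * q ^ 2 / Λ = K * q ^ 2 * (A₀ / Λ / 2) := by ring
    rw [e]
    linarith

/-- The mixed and first order terms of the combined current, absorbed into its positive part. -/
lemma bulk_lower {rp c₁ C₁ K A₀ c m ω p φ q ε Λ N₀ U D R N w : ℝ}
    (hrp : 0 < rp) (hc₁ : 0 < c₁) (hK : 0 < K) (hA : 0 < A₀) (hm : 0 < m)
    (hc : 0 < c) (hcc₁ : c ≤ c₁ / (4 * rp)) (hcK : c ≤ K / 32)
    (hcm : c ≤ K * A₀ / (64 * m ^ 2)) (hcA : c ≤ K * A₀ / 4)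
    (hω : ω ^ 2 ≤ m ^ 2) (hp : 0 < p) (hq : q = 1 - rp * p) (hq0 : 0 < q) (hε : 0 < ε)
    (hφ1 : c₁ * q ≤ φ) (hφ2 : φ ≤ C₁ * q) (hΛ : 1 ≤ Λ)
    (hU : 0 ≤ U) (hN : 0 ≤ N) (hRU : R ^ 2 ≤ U * D)
    (hND : N ≤ 2 * D + 2 * ω ^ 2 * U) (hD : 0 ≤ D)
    (hN₀ : K * A₀ / 2 * q ^ 2 / Λ ≤ N₀ - 2 * K * rp ^ 2 * C₁ ^ 2 * q ^ 2 * p ^ 4)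
    (hw : w = q / (q + ε) ^ 2) :
    c / Λ * (w * N + q ^ 2 * U) ≤ rp * p ^ 2 * φ / (q + ε) ^ 2 * N + N₀ * U
      + K * q ^ 2 * D + 2 * K * q * (rp * p ^ 2 * φ) * R := by
  have hφ0 : 0 < φ := lt_of_lt_of_le (by positivity) hφ1
  have hΛ0 : 0 < Λ := by linarith
  have hq1 : q < 1 := by rw [hq]; nlinarith [mul_pos hrp hp]
  have hw0 : 0 < w := by rw [hw]; positivity
  have hmix : -(K * q ^ 2 / 2 * D + 2 * K * rp ^ 2 * C₁ ^ 2 * q ^ 2 * p ^ 4 * U)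
      ≤ 2 * K * q * (rp * p ^ 2 * φ) * R := by
    have h1 : -(q ^ 2 / 2 * D + 2 * (rp * p ^ 2 * φ) ^ 2 * U)
        ≤ 2 * q * (rp * p ^ 2 * φ) * R := by
      set t := rp * p ^ 2 * φ with ht
      have ht0 : 0 < t := by positivity
      have h2 : (2 * q * t * R) ^ 2 ≤ (q ^ 2 / 2 * D + 2 * t ^ 2 * U) ^ 2 := by
        have : (2 * q * t * R) ^ 2 = 4 * q ^ 2 * t ^ 2 * R ^ 2 := by ring
        rw [this]
        have h3 : 4 * q ^ 2 * t ^ 2 * R ^ 2 ≤ 4 * q ^ 2 * t ^ 2 * (U * D) := by gcongr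
        nlinarith [sq_nonneg (q ^ 2 / 2 * D - 2 * t ^ 2 * U)]
      have h4 := abs_le_of_sq_le_sq h2 (by positivity)
      exact (abs_le.1 h4).1
    have h5 : (rp * p ^ 2 * φ) ^ 2 ≤ (rp * p ^ 2 * (C₁ * q)) ^ 2 := by gcongr
    have h6 := mul_le_mul_of_nonneg_left h5 (by positivity : 0 ≤ 2 * K * U)
    have h7 := mul_le_mul_of_nonneg_left h1 hK.le
    linarith
  have hNU : K * A₀ / 2 * q ^ 2 / Λ * U
      ≤ N₀ * U - 2 * K * rp ^ 2 * C₁ ^ 2 * q ^ 2 * p ^ 4 * U := by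
    have := mul_le_mul_of_nonneg_right hN₀ hU
    linarith
  have hquarter : c / Λ * (q ^ 2 * U) ≤ (K * A₀ / 2 * q ^ 2 / Λ * U) / 2 := by
    have h1 : c / Λ * (q ^ 2 * U) = c * (q ^ 2 * U / Λ) := by ring
    have h2 : (K * A₀ / 2 * q ^ 2 / Λ * U) / 2 = K * A₀ / 4 * (q ^ 2 * U / Λ) := by ring
    rw [h1, h2]
    gcongr
  have hmain : c / Λ * (w * N) ≤ rp * p ^ 2 * φ / (q + ε) ^ 2 * N
      + (K * A₀ / 2 * q ^ 2 / Λ * U) / 2 + K * q ^ 2 / 2 * D := by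
    rcases le_total q (1 / 2) with h | h
    · have hp1 : 1 / (2 * rp) ≤ p := by
        rw [div_le_iff₀ (by positivity)]; nlinarith
      have h1 : c / Λ ≤ c₁ / (4 * rp) := (div_le_self hc.le hΛ).trans hcc₁
      have h2 : c / Λ * w ≤ rp * p ^ 2 * φ / (q + ε) ^ 2 := by
        calc c / Λ * w ≤ c₁ / (4 * rp) * w := by gcongr
          _ = rp * (1 / (2 * rp)) ^ 2 * (c₁ * q) / (q + ε) ^ 2 := by
            rw [hw]; field_simp; norm_num
          _ ≤ rp * p ^ 2 * φ / (q + ε) ^ 2 := by gcongr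
      have h3 := mul_le_mul_of_nonneg_right h2 hN
      have h4 : 0 ≤ (K * A₀ / 2 * q ^ 2 / Λ * U) / 2 := by positivity
      have h5 : 0 ≤ K * q ^ 2 / 2 * D := by positivity
      linarith
    · have h1 : w ≤ 8 * q ^ 2 := by
        rw [hw, div_le_iff₀ (by positivity)]
        have : q ^ 2 ≤ (q + ε) ^ 2 := by gcongr; linarith
        have h3 : q ≤ 8 * q ^ 2 * q ^ 2 := by
          have h4 : (1 / 2 : ℝ) ^ 3 ≤ q ^ 3 := by gcongr
          have h5 := mul_le_mul_of_nonneg_right h4 hq0.le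
          have e : 8 * q ^ 2 * q ^ 2 = 8 * q ^ 3 * q := by ring
          rw [e]
          linarith
        exact h3.trans (mul_le_mul_of_nonneg_left this (by positivity))
      have h2 : w * N ≤ 8 * q ^ 2 * (2 * D + 2 * m ^ 2 * U) := by
        have : 2 * D + 2 * ω ^ 2 * U ≤ 2 * D + 2 * m ^ 2 * U := by gcongr
        gcongr
        linarith
      have h3 : c / Λ * (w * N) ≤ c / Λ * (8 * q ^ 2 * (2 * D + 2 * m ^ 2 * U)) := by gcongr
      have h4 : c / Λ * (8 * q ^ 2 * (2 * D)) ≤ K * q ^ 2 / 2 * D := by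
        have : c / Λ ≤ K / 32 := (div_le_self hc.le hΛ).trans hcK
        calc c / Λ * (8 * q ^ 2 * (2 * D)) ≤ K / 32 * (8 * q ^ 2 * (2 * D)) := by gcongr
          _ = K * q ^ 2 / 2 * D := by ring
      have h5 : c / Λ * (8 * q ^ 2 * (2 * m ^ 2 * U)) ≤ (K * A₀ / 2 * q ^ 2 / Λ * U) / 2 := by
        rw [le_div_iff₀ (by positivity)] at hcm
        calc c / Λ * (8 * q ^ 2 * (2 * m ^ 2 * U))
            = (c * (64 * m ^ 2)) * (q ^ 2 * U / Λ / 4) := by ring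
          _ ≤ (K * A₀) * (q ^ 2 * U / Λ / 4) := by gcongr
          _ = _ := by ring
      have h6 : 0 ≤ rp * p ^ 2 * φ / (q + ε) ^ 2 * N := by positivity
      linarith
  linarith

lemma le_add_of_sq_le_four_mul {X a b : ℝ} (ha : 0 ≤ a) (hb : 0 ≤ b)
    (h : X ^ 2 ≤ 4 * (a * b)) : X ≤ a + b := by
  refine (abs_le.1 (abs_le_of_sq_le_sq (?_ : X ^ 2 ≤ (a + b) ^ 2) (add_nonneg ha hb))).2
  nlinarith [sq_nonneg (a - b)]

/-- The derivative of the combined redshift and Lagrangian current, for a solution of the radial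
equation written in real components. -/
lemma hasDerivAt_current {x₁ x₂ y₁ y₂ g B χ : ℝ → ℝ} {s V ω h₁ h₂ g' B' χ' : ℝ}
    (hx₁ : HasDerivAt x₁ (y₁ s) s) (hx₂ : HasDerivAt x₂ (y₂ s) s)
    (hy₁ : HasDerivAt y₁ (V * x₁ s + h₁) s) (hy₂ : HasDerivAt y₂ (V * x₂ s + h₂) s)
    (hg : HasDerivAt g g' s) (hB : HasDerivAt B B' s) (hχ : HasDerivAt χ χ' s)
    (hBg : B s = g s * (V + ω ^ 2)) :
    HasDerivAt (fun t => g t * ((y₁ t - ω * x₂ t) ^ 2 + (y₂ t + ω * x₁ t) ^ 2)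
        - B t * (x₁ t ^ 2 + x₂ t ^ 2) - χ t * (x₁ t * y₁ t + x₂ t * y₂ t))
      (g' * ((y₁ s - ω * x₂ s) ^ 2 + (y₂ s + ω * x₁ s) ^ 2)
        + 2 * g s * ((y₁ s - ω * x₂ s) * h₁ + (y₂ s + ω * x₁ s) * h₂)
        - B' * (x₁ s ^ 2 + x₂ s ^ 2) - χ' * (x₁ s * y₁ s + x₂ s * y₂ s)
        - χ s * (y₁ s ^ 2 + y₂ s ^ 2 + V * (x₁ s ^ 2 + x₂ s ^ 2)
          + (x₁ s * h₁ + x₂ s * h₂))) s := by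
  have hv₁ := hy₁.sub (hx₂.const_mul ω)
  have hv₂ := hy₂.add (hx₁.const_mul ω)
  have H := ((hg.mul ((hv₁.pow 2).add (hv₂.pow 2))).sub
    (hB.mul ((hx₁.pow 2).add (hx₂.pow 2)))).sub (hχ.mul ((hx₁.mul hy₁).add (hx₂.mul hy₂)))
  refine H.congr_deriv ?_
  simp only [Pi.add_apply, Pi.sub_apply, Pi.mul_apply, Pi.pow_apply, hBg]
  push_cast
  ring

/-- The redshift coefficient is increasing near the horizon. -/
lemma hasDerivAt_redshift_coeff {p : ℝ → ℝ} {s φ rm rp M E m l ε : ℝ}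
    (hp : HasDerivAt p (-(p s) ^ 2 * φ) s) (hφ : 0 ≤ φ) (hp0 : 0 < p s) (hq0 : 0 < 1 - rp * p s)
    (hε : 0 < ε) (hG0 : 0 ≤ 1 - rm * p s) (hrm : 0 ≤ rm) (hrp : 0 < rp)
    (hMp : M * p s ≤ 1) (hEM : E ^ 2 * p s ≤ M) (hl : 6 ≤ l) :
    ∃ B', HasDerivAt (fun t => ((1 - rp * p t) / (1 - rp * p t + ε) + 4 * (1 - rp * p t))
        * (1 - rm * p t) * (m ^ 2 + l * p t ^ 2 + (2 * M * p t ^ 3 - 2 * E ^ 2 * p t ^ 4))) B' s ∧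
      φ * p s ^ 3 * (1 - rm * p s) * l * (1 - 16 * (1 - rp * p s)) ≤ B' := by
  have hq : HasDerivAt (fun t => 1 - rp * p t) (rp * (p s ^ 2 * φ)) s :=
    ((hp.const_mul rp).const_sub 1).congr_deriv (by ring)
  have hG : HasDerivAt (fun t => 1 - rm * p t) (rm * (p s ^ 2 * φ)) s :=
    ((hp.const_mul rm).const_sub 1).congr_deriv (by ring)
  have hZ : HasDerivAt (fun t => m ^ 2 + l * p t ^ 2 + (2 * M * p t ^ 3 - 2 * E ^ 2 * p t ^ 4))
      (-(p s ^ 2 * φ) * (2 * l * p s + 6 * M * p s ^ 2 - 8 * E ^ 2 * p s ^ 3)) s := by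
    refine ((((hp.pow 2).const_mul l).const_add (m ^ 2)).add
      (((hp.pow 3).const_mul (2 * M)).sub ((hp.pow 4).const_mul (2 * E ^ 2)))).congr_deriv ?_
    push_cast
    ring
  have hne : 1 - rp * p s + ε ≠ 0 := by positivity
  have hh : HasDerivAt (fun t => (1 - rp * p t) / (1 - rp * p t + ε) + 4 * (1 - rp * p t))
      (rp * (p s ^ 2 * φ) * (ε / (1 - rp * p s + ε) ^ 2 + 4)) s := by
    refine ((hq.div (hq.add_const ε) hne).add (hq.const_mul 4)).congr_deriv ?_
    field_simp
    ring
  refine ⟨_, (hh.mul hG).mul hZ, ?_⟩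
  set P := p s
  set q := 1 - rp * P with hqdef
  set G := 1 - rm * P
  set h := q / (q + ε) + 4 * q with hhdef
  have h0 : 0 ≤ h := by positivity
  have h1 : h ≤ 1 + 4 * q := by
    have : q / (q + ε) ≤ 1 := by rw [div_le_one (by positivity)]; linarith
    linarith
  have hZl : l * P ^ 2 ≤ m ^ 2 + l * P ^ 2 + (2 * M * P ^ 3 - 2 * E ^ 2 * P ^ 4) := by
    have : 0 ≤ 2 * P ^ 3 * (M - E ^ 2 * P) := mul_nonneg (by positivity) (by linarith)
    nlinarith [sq_nonneg m]
  have hZ0 : 0 ≤ m ^ 2 + l * P ^ 2 + (2 * M * P ^ 3 - 2 * E ^ 2 * P ^ 4) :=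
    le_trans (by positivity) hZl
  set Z := m ^ 2 + l * P ^ 2 + (2 * M * P ^ 3 - 2 * E ^ 2 * P ^ 4)
  have hZ'u : 2 * l * P + 6 * M * P ^ 2 - 8 * E ^ 2 * P ^ 3 ≤ 3 * l * P := by
    have e1 : 0 ≤ 8 * E ^ 2 * P ^ 3 := by positivity
    have e2 : 6 * (M * P) * P ≤ l * P := by
      apply mul_le_mul_of_nonneg_right _ hp0.le
      linarith
    nlinarith
  have k1 : h * (2 * l * P + 6 * M * P ^ 2 - 8 * E ^ 2 * P ^ 3) ≤ (1 + 4 * q) * (3 * l * P) := by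
    calc _ ≤ h * (3 * l * P) := by gcongr
      _ ≤ _ := by gcongr
  have k2 : 4 * rp * (l * P ^ 2) ≤ rp * (ε / (q + ε) ^ 2 + 4) * Z := by
    have : 4 ≤ ε / (q + ε) ^ 2 + 4 := by
      have : 0 ≤ ε / (q + ε) ^ 2 := by positivity
      linarith
    calc 4 * rp * (l * P ^ 2) = rp * 4 * (l * P ^ 2) := by ring
      _ ≤ _ := by gcongr
  have k3 : 0 ≤ P ^ 2 * φ * (h * rm * Z) := by positivity
  have k4 : 4 * rp * (l * P ^ 2) - (1 + 4 * q) * (3 * l * P) = P * l * (1 - 16 * q) := by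
    rw [hqdef]; ring
  have k5 := mul_le_mul_of_nonneg_left (sub_le_sub k2 k1) (by positivity : 0 ≤ P ^ 2 * φ * G)
  rw [k4] at k5
  change _ ≤ (rp * (P ^ 2 * φ) * (ε / (q + ε) ^ 2 + 4) * G + h * (rm * (P ^ 2 * φ))) * Z
    + h * G * (-(P ^ 2 * φ) * (2 * l * P + 6 * M * P ^ 2 - 8 * E ^ 2 * P ^ 3))
  linarith

/-- Pointwise bound for the derivative of the combined current. -/
lemma deriv_current_le {rp c₁ C₁ g₀ γ K A₀ c M m ω p φ q G ε l Λ B' V U D R N S T h : ℝ}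
    (hrp : 0 < rp) (hc₁ : 0 < c₁) (hC₁ : 0 < C₁) (hg₀ : 0 < g₀) (hM : 0 < M) (hm : 0 < m)
    (hγ : γ = g₀ / 96) (hK : K = 16 * C₁ / (rp * γ)) (hA₀ : A₀ = 2 * M ^ 2 * m ^ 4 / γ)
    (hΛ0 : 1 ≤ Λ) (hΛl : Λ ≤ l)
    (hΛ1 : K * (2 * M * m ^ 2 / rp + 2 * C₁ ^ 2 / rp ^ 2) ≤ c₁ * g₀ / (16 * rp ^ 3) * Λ)
    (hΛ2 : 2 * C₁ ^ 2 ≤ γ * Λ)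
    (hc : 0 < c) (hcc₁ : c ≤ c₁ / (4 * rp)) (hcK : c ≤ K / 32)
    (hcm : c ≤ K * A₀ / (64 * m ^ 2)) (hcA : c ≤ K * A₀ / 4)
    (hω : ω ^ 2 ≤ m ^ 2) (hε : 0 < ε) (hε1 : ε ≤ 1)
    (hp : 0 < p) (hq : q = 1 - rp * p) (hq0 : 0 < q) (hφ1 : c₁ * q ≤ φ) (hφ2 : φ ≤ C₁ * q)
    (hG1 : g₀ ≤ G) (hG2 : G ≤ 1) (hB' : φ * p ^ 3 * G * l * (1 - 16 * q) ≤ B')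
    (hV : A₀ / Λ - 2 * M * m ^ 2 * p + G * q * l * p ^ 2 ≤ V)
    (hU : 0 ≤ U) (hD : 0 ≤ D) (hN : 0 ≤ N) (hh : 0 ≤ h)
    (hR : R ^ 2 ≤ U * D) (hND : N ≤ 2 * D + 2 * ω ^ 2 * U) (hS : S ^ 2 ≤ N * h)
    (hT : T ^ 2 ≤ U * h) :
    -(rp * p ^ 2 * φ) / (q + ε) ^ 2 * N + 2 * ((q + ε)⁻¹ + 4) * S - B' * U
        - 2 * K * q * (rp * p ^ 2 * φ) * R - K * q ^ 2 * (D + V * U + T)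
      ≤ 2 * Λ / c * (81 + K ^ 2) * (q⁻¹ * h)
        - c / (2 * Λ) * (q / (q + ε) ^ 2 * N + q ^ 2 * U) := by
  have hΛ : 0 < Λ := by linarith
  have hγ0 : 0 < γ := by rw [hγ]; positivity
  have hK0 : 0 < K := by rw [hK]; positivity
  have hA0 : 0 < A₀ := by rw [hA₀]; positivity
  have hq1 : q < 1 := by
    have := mul_pos hrp hp
    linarith
  have hcoef := zeroth_order_coeff_lower hrp hc₁ hC₁ hg₀ hM hγ hK hA₀ hp
    hq hq0 hφ1 hφ2 hG1 hG2 hΛ hΛl hΛ1 hΛ2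
  have hN₀ : K * A₀ / 2 * q ^ 2 / Λ ≤ (B' + K * q ^ 2 * V)
      - 2 * K * rp ^ 2 * C₁ ^ 2 * q ^ 2 * p ^ 4 := by
    have := mul_le_mul_of_nonneg_left hV (by positivity : 0 ≤ K * q ^ 2)
    linarith
  have hbulk := bulk_lower hrp hc₁ hK0 hA0 hm hc hcc₁ hcK hcm hcA hω hp hq hq0 hε hφ1 hφ2 hΛ0
    hU hN hR hND hD hN₀ rfl
  have hS' : 2 * ((q + ε)⁻¹ + 4) * S ≤ c / (2 * Λ) * (q / (q + ε) ^ 2 * N)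
      + 2 * Λ / c * (81 * (q⁻¹ * h)) := by
    refine le_add_of_sq_le_four_mul (by positivity) (by positivity) ?_
    have e2 : (q + ε)⁻¹ + 4 ≤ 9 / (q + ε) := by
      rw [le_div_iff₀ (by positivity), add_mul, inv_mul_cancel₀ (by positivity)]
      linarith
    calc (2 * ((q + ε)⁻¹ + 4) * S) ^ 2 = 4 * ((q + ε)⁻¹ + 4) ^ 2 * S ^ 2 := by ring
      _ ≤ 4 * (9 / (q + ε)) ^ 2 * (N * h) := by gcongr
      _ = _ := by field_simp; ring
  have hT' : -(K * q ^ 2) * T ≤ c / (2 * Λ) * (q ^ 2 * U)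
      + 2 * Λ / c * (K ^ 2 * (q⁻¹ * h)) := by
    refine le_add_of_sq_le_four_mul (by positivity) (by positivity) ?_
    have e2 : q ^ 4 ≤ 4 * q := by
      have : q ^ 4 ≤ q ^ 1 := pow_le_pow_of_le_one hq0.le hq1.le (by norm_num)
      linarith
    calc (-(K * q ^ 2) * T) ^ 2 = K ^ 2 * q ^ 4 * T ^ 2 := by ring
      _ ≤ K ^ 2 * (4 * q) * (U * h) := by gcongr
      _ = _ := by field_simp
  have e : c / Λ = c / (2 * Λ) + c / (2 * Λ) := by field_simp; norm_num
  rw [e] at hbulk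
  rw [neg_div]
  linarith

lemma sq_add_mul_le (a b c d : ℝ) :
    (a * c + b * d) ^ 2 ≤ (a ^ 2 + b ^ 2) * (c ^ 2 + d ^ 2) := by
  nlinarith [sq_nonneg (a * d - b * c)]

lemma abs_add_mul_le (a b c d : ℝ) :
    |a * c + b * d| ≤ (a ^ 2 + b ^ 2) + (c ^ 2 + d ^ 2) := by
  rw [abs_le]
  constructor <;> nlinarith [sq_nonneg (a + c), sq_nonneg (b + d), sq_nonneg (a - c),
    sq_nonneg (b - d)]

lemma twisted_sq_le (a b c d ω : ℝ) :
    (c - ω * b) ^ 2 + (d + ω * a) ^ 2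
      ≤ 2 * (c ^ 2 + d ^ 2) + 2 * ω ^ 2 * (a ^ 2 + b ^ 2) := by
  nlinarith [sq_nonneg (c + ω * b), sq_nonneg (d - ω * a)]

lemma sq_le_mul_twisted_sq (a b c d ω : ℝ) :
    (a * c + b * d) ^ 2 ≤ (a ^ 2 + b ^ 2) * ((c - ω * b) ^ 2 + (d + ω * a) ^ 2) := by
  have h := sq_add_mul_le a b (c - ω * b) (d + ω * a)
  have e : a * (c - ω * b) + b * (d + ω * a) = a * c + b * d := by ring
  rwa [e] at h

set_option maxHeartbeats 1000000 in
/-- The weighted estimate for `v = u' + iωu` and `u`, with the redshift weight regularised by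
`ε`. -/
lemma lintegral_regularized_le {p φ x₁ x₂ y₁ y₂ h₁ h₂ : ℝ → ℝ}
    {rm rp M E m l ε ω Λ c₁ C₁ g₀ γ K A₀ c b : ℝ}
    (hrm : 0 ≤ rm) (hrp : 0 < rp) (hc₁ : 0 < c₁) (hC₁ : 0 < C₁) (hg₀ : 0 < g₀) (hM : 0 < M)
    (hm : 0 < m) (hMrp : M ≤ rp) (hEM : E ^ 2 ≤ M ^ 2) (hsum : rm + rp = 2 * M)
    (hprod : rm * rp = E ^ 2) (hg₀' : g₀ = 1 - rm / rp)
    (hγ : γ = g₀ / 96) (hK : K = 16 * C₁ / (rp * γ)) (hA₀ : A₀ = 2 * M ^ 2 * m ^ 4 / γ)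
    (hΛ0 : 1 ≤ Λ) (hΛl : Λ ≤ l) (hl : 6 ≤ l)
    (hΛ1 : K * (2 * M * m ^ 2 / rp + 2 * C₁ ^ 2 / rp ^ 2) ≤ c₁ * g₀ / (16 * rp ^ 3) * Λ)
    (hΛ2 : 2 * C₁ ^ 2 ≤ γ * Λ)
    (hc : 0 < c) (hcc₁ : c ≤ c₁ / (4 * rp)) (hcK : c ≤ K / 32)
    (hcm : c ≤ K * A₀ / (64 * m ^ 2)) (hcA : c ≤ K * A₀ / 4)
    (hω : ω ^ 2 ≤ m ^ 2) (hωA : A₀ / Λ ≤ m ^ 2 - ω ^ 2) (hε : 0 < ε) (hε1 : ε ≤ 1)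
    (hp : ∀ s, HasDerivAt p (-(p s) ^ 2 * φ s) s) (hp0 : ∀ s, 0 < p s)
    (hq0 : ∀ s, 0 < 1 - rp * p s)
    (hφ1 : ∀ s, c₁ * (1 - rp * p s) ≤ φ s) (hφ2 : ∀ s, φ s ≤ C₁ * (1 - rp * p s))
    (hx₁ : ∀ s, HasDerivAt x₁ (y₁ s) s) (hx₂ : ∀ s, HasDerivAt x₂ (y₂ s) s)
    (hy₁ : ∀ s, HasDerivAt y₁ ((-ω ^ 2 + (1 - rp * p s) * (1 - rm * p s) * (m ^ 2 + l * p s ^ 2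
      + (2 * M * p s ^ 3 - 2 * E ^ 2 * p s ^ 4))) * x₁ s + h₁ s) s)
    (hy₂ : ∀ s, HasDerivAt y₂ ((-ω ^ 2 + (1 - rp * p s) * (1 - rm * p s) * (m ^ 2 + l * p s ^ 2
      + (2 * M * p s ^ 3 - 2 * E ^ 2 * p s ^ 4))) * x₂ s + h₂ s) s)
    (hh₁ : Continuous h₁) (hh₂ : Continuous h₂)
    (hbotU : ∀ᶠ s in Filter.atBot, x₁ s ^ 2 + x₂ s ^ 2 ≤ b)
    (hbotN : Filter.Tendsto (fun s => (y₁ s - ω * x₂ s) ^ 2 + (y₂ s + ω * x₁ s) ^ 2)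
      Filter.atBot (nhds 0))
    (htopU : Filter.Tendsto (fun s => x₁ s ^ 2 + x₂ s ^ 2) Filter.atTop (nhds 0))
    (htopD : Filter.Tendsto (fun s => y₁ s ^ 2 + y₂ s ^ 2) Filter.atTop (nhds 0)) :
    ∫⁻ s, ENNReal.ofReal (c / (2 * Λ) * ((1 - rp * p s) / (1 - rp * p s + ε) ^ 2
        * ((y₁ s - ω * x₂ s) ^ 2 + (y₂ s + ω * x₁ s) ^ 2)
        + (1 - rp * p s) ^ 2 * (x₁ s ^ 2 + x₂ s ^ 2)))
      ≤ ∫⁻ s, ENNReal.ofReal (2 * Λ / c * (81 + K ^ 2)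
        * ((1 - rp * p s)⁻¹ * (h₁ s ^ 2 + h₂ s ^ 2))) := by
  have hΛ : 0 < Λ := by linarith
  have hγ0 : 0 < γ := by rw [hγ]; positivity
  have hK0 : 0 < K := by rw [hK]; positivity
  have hA0 : 0 < A₀ := by rw [hA₀]; positivity
  have hpc : Continuous p := continuous_iff_continuousAt.2 fun s => (hp s).continuousAt
  have hx₁c : Continuous x₁ := continuous_iff_continuousAt.2 fun s => (hx₁ s).continuousAt
  have hx₂c : Continuous x₂ := continuous_iff_continuousAt.2 fun s => (hx₂ s).continuousAt
  have hy₁c : Continuous y₁ := continuous_iff_continuousAt.2 fun s => (hy₁ s).continuousAt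
  have hy₂c : Continuous y₂ := continuous_iff_continuousAt.2 fun s => (hy₂ s).continuousAt
  have hq1 : ∀ s, 1 - rp * p s < 1 := fun s => by
    have := mul_pos hrp (hp0 s)
    linarith
  have hrmp : rm ≤ rp := by
    have : 0 < 1 - rm / rp := hg₀' ▸ hg₀
    rw [sub_pos, div_lt_one hrp] at this
    exact this.le
  have hprp : ∀ s, p s ≤ 1 / rp := fun s => by
    rw [le_div_iff₀ hrp]; linarith [hq0 s]
  have hG1 : ∀ s, g₀ ≤ 1 - rm * p s := fun s => by
    rw [hg₀']
    have := mul_le_mul_of_nonneg_left (hprp s) hrm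
    rw [mul_one_div] at this
    linarith
  have hG2 : ∀ s, 1 - rm * p s ≤ 1 := fun s => by
    have := mul_nonneg hrm (hp0 s).le
    linarith
  have hMp : ∀ s, M * p s ≤ 1 := fun s => by
    have := mul_le_mul_of_nonneg_right hMrp (hp0 s).le
    linarith [hq0 s]
  have hEp : ∀ s, E ^ 2 * p s ≤ M := fun s => by
    have h1 := mul_le_mul_of_nonneg_right hEM (hp0 s).le
    have h2 := mul_le_mul_of_nonneg_left (hMp s) hM.le
    linarith
  have hφ0 : ∀ s, 0 ≤ φ s := fun s => (mul_pos hc₁ (hq0 s)).le.trans (hφ1 s)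
  choose B' hB' hB'l using fun s => hasDerivAt_redshift_coeff (m := m) (l := l) (hp s) (hφ0 s)
    (hp0 s) (hq0 s) hε (hg₀.le.trans (hG1 s)) hrm hrp (hMp s) (hEp s) hl
  have hq : ∀ s, HasDerivAt (fun t => 1 - rp * p t) (rp * p s ^ 2 * φ s) s := fun s =>
    (((hp s).const_mul rp).const_sub 1).congr_deriv (by ring)
  have hg : ∀ s, HasDerivAt (fun t => (1 - rp * p t + ε)⁻¹ + 4)
      (-(rp * p s ^ 2 * φ s) / (1 - rp * p s + ε) ^ 2) s := fun s =>
    (((hq s).add_const ε).inv (by linarith [hq0 s])).add_const 4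
  have hχ : ∀ s, HasDerivAt (fun t => K * (1 - rp * p t) ^ 2)
      (2 * K * (1 - rp * p s) * (rp * p s ^ 2 * φ s)) s := fun s => by
    refine (((hq s).pow 2).const_mul K).congr_deriv ?_
    push_cast
    ring
  have hJ := fun s => hasDerivAt_current (ω := ω) (hx₁ s) (hx₂ s) (hy₁ s) (hy₂ s) (hg s) (hB' s)
    (hχ s) (by
      have : 1 - rp * p s + ε ≠ 0 := by linarith [hq0 s]
      field_simp
      ring)
  have hqε : ∀ s, 1 - rp * p s + ε ≠ 0 := fun s => by linarith [hq0 s]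
  have hKR : ∀ s R, |K * (1 - rp * p s) ^ 2 * R| ≤ K * |R| := fun s R => by
    have h0 := hq0 s
    have : (1 - rp * p s) ^ 2 ≤ 1 := pow_le_one₀ h0.le (hq1 s).le
    rw [abs_mul, abs_of_pos (by positivity)]
    exact mul_le_mul_of_nonneg_right (mul_le_of_le_one_right hK0.le this) (abs_nonneg R)
  have hredshift : ∀ s, 0 ≤ ((1 - rp * p s) / (1 - rp * p s + ε) + 4 * (1 - rp * p s))
        * (1 - rm * p s) * (m ^ 2 + l * p s ^ 2 + (2 * M * p s ^ 3 - 2 * E ^ 2 * p s ^ 4)) ∧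
      ((1 - rp * p s) / (1 - rp * p s + ε) + 4 * (1 - rp * p s))
        * (1 - rm * p s) * (m ^ 2 + l * p s ^ 2 + (2 * M * p s ^ 3 - 2 * E ^ 2 * p s ^ 4))
        ≤ 5 * (m ^ 2 + l * (1 / rp) ^ 2 + 2 * M * (1 / rp) ^ 3) := fun s => by
    have h0 := hq0 s
    have hG0 : 0 < 1 - rm * p s := hg₀.trans_le (hG1 s)
    have hps := hp0 s
    have hps' := hprp s
    have hG2s := hG2 s
    have hq1s := hq1 s
    have e1 : 0 ≤ 2 * p s ^ 3 * (M - E ^ 2 * p s) :=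
      mul_nonneg (by positivity) (by linarith [hEp s])
    have e2 : 0 ≤ m ^ 2 + l * p s ^ 2 := by positivity
    have e3 : 0 ≤ 2 * E ^ 2 * p s ^ 4 := by positivity
    have e4 : (1 - rp * p s) / (1 - rp * p s + ε) ≤ 1 := by
      rw [div_le_one (by positivity)]; linarith
    have hZ0 : 0 ≤ m ^ 2 + l * p s ^ 2 + (2 * M * p s ^ 3 - 2 * E ^ 2 * p s ^ 4) := by linarith
    refine ⟨by positivity, ?_⟩
    calc ((1 - rp * p s) / (1 - rp * p s + ε) + 4 * (1 - rp * p s)) * (1 - rm * p s)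
          * (m ^ 2 + l * p s ^ 2 + (2 * M * p s ^ 3 - 2 * E ^ 2 * p s ^ 4))
        ≤ (1 + 4 * 1) * 1 * (m ^ 2 + l * p s ^ 2 + 2 * M * p s ^ 3) := by
          gcongr
          linarith
      _ ≤ (1 + 4 * 1) * 1 * (m ^ 2 + l * (1 / rp) ^ 2 + 2 * M * (1 / rp) ^ 3) := by gcongr
      _ = _ := by ring
  refine lintegral_le_lintegral_of_hasDerivAt hJ ?_ ?_ ?_ ?_ ?_ ?_ ?_
  · fun_prop (disch := intro s; exact pow_ne_zero 2 (hqε s))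
  · have : Continuous fun s => (1 - rp * p s)⁻¹ :=
      Continuous.inv₀ (by fun_prop) fun s => (hq0 s).ne'
    fun_prop
  · intro s
    have := hq0 s
    positivity
  · intro s
    have := hq0 s
    positivity
  · intro s
    have hZ : l * p s ^ 2 ≤ l * p s ^ 2 + (2 * M * p s ^ 3 - 2 * E ^ 2 * p s ^ 4) := by
      have : 0 ≤ 2 * p s ^ 3 * (M - E ^ 2 * p s) :=
        mul_nonneg (pow_nonneg (hp0 s).le _ |> mul_nonneg zero_le_two) (by linarith [hEp s])
      linarith
    have h0 := hq0 s
    have hqs := hq1 s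
    have hG1s := hG1 s
    have hG0 : 0 < 1 - rm * p s := hg₀.trans_le hG1s
    have hV : A₀ / Λ - 2 * M * m ^ 2 * p s + (1 - rm * p s) * (1 - rp * p s) * l * p s ^ 2
        ≤ -ω ^ 2 + (1 - rp * p s) * (1 - rm * p s) * (m ^ 2 + l * p s ^ 2
          + (2 * M * p s ^ 3 - 2 * E ^ 2 * p s ^ 4)) := by
      have e1 : (1 - rp * p s) * (1 - rm * p s) = 1 - 2 * M * p s + E ^ 2 * p s ^ 2 := by
        rw [← hsum, ← hprod]; ring
      have e2 : 0 ≤ E ^ 2 * p s ^ 2 * m ^ 2 := by positivity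
      have e3 := mul_le_mul_of_nonneg_left hZ (mul_pos h0 hG0).le
      have e4 : (1 - rp * p s) * (1 - rm * p s) * m ^ 2
          = m ^ 2 - 2 * M * m ^ 2 * p s + E ^ 2 * p s ^ 2 * m ^ 2 := by rw [e1]; ring
      linarith
    refine deriv_current_le (g₀ := g₀) (γ := γ) hrp hc₁ hC₁ hg₀ hM hm hγ hK hA₀ hΛ0 hΛl hΛ1 hΛ2
      hc hcc₁ hcK hcm hcA hω hε hε1 (hp0 s) rfl h0 (hφ1 s) (hφ2 s) hG1s (hG2 s) (hB'l s) hV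
      (by positivity) (by positivity) (by positivity) (by positivity) ?_ ?_ ?_ ?_
    · exact sq_add_mul_le _ _ _ _
    · exact twisted_sq_le _ _ _ _ _
    · exact sq_add_mul_le _ _ _ _
    · exact sq_add_mul_le _ _ _ _
  · intro η hη
    have hlim : Filter.Tendsto (fun s => (ε⁻¹ + 4) * ((y₁ s - ω * x₂ s) ^ 2
        + (y₂ s + ω * x₁ s) ^ 2) + K * √(b * ((y₁ s - ω * x₂ s) ^ 2 + (y₂ s + ω * x₁ s) ^ 2)))
        Filter.atBot (nhds 0) := by
      simpa using (hbotN.const_mul (ε⁻¹ + 4)).add (((hbotN.const_mul b).sqrt).const_mul K)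
    filter_upwards [hlim.eventually_le_const hη, hbotU] with s hs hUs
    refine le_trans ?_ hs
    have h0 := hq0 s
    have hB0 := hredshift s
    have hU0 : 0 ≤ x₁ s ^ 2 + x₂ s ^ 2 := by positivity
    have hN0 : 0 ≤ (y₁ s - ω * x₂ s) ^ 2 + (y₂ s + ω * x₁ s) ^ 2 := by positivity
    have e1 : (1 - rp * p s + ε)⁻¹ + 4 ≤ ε⁻¹ + 4 := by
      gcongr
      linarith
    have e2 := mul_le_mul_of_nonneg_right e1 hN0
    have e3 := mul_nonneg hB0.1 hU0
    have e4 : |x₁ s * y₁ s + x₂ s * y₂ s|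
        ≤ √(b * ((y₁ s - ω * x₂ s) ^ 2 + (y₂ s + ω * x₁ s) ^ 2)) :=
      Real.abs_le_sqrt ((sq_le_mul_twisted_sq _ _ _ _ _).trans
        (mul_le_mul_of_nonneg_right hUs hN0))
    have e5 := hKR s (x₁ s * y₁ s + x₂ s * y₂ s)
    have e6 := mul_le_mul_of_nonneg_left e4 hK0.le
    have e7 := (abs_le.1 e5).1
    linarith
  · intro η hη
    have hlim : Filter.Tendsto (fun s => 5 * (m ^ 2 + l * (1 / rp) ^ 2 + 2 * M * (1 / rp) ^ 3)
        * (x₁ s ^ 2 + x₂ s ^ 2) + K * ((x₁ s ^ 2 + x₂ s ^ 2) + (y₁ s ^ 2 + y₂ s ^ 2)))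
        Filter.atTop (nhds 0) := by
      simpa only [mul_zero, add_zero] using
        (htopU.const_mul (5 * (m ^ 2 + l * (1 / rp) ^ 2 + 2 * M * (1 / rp) ^ 3))).add
          ((htopU.add htopD).const_mul K)
    filter_upwards [hlim.eventually_le_const hη] with s hs
    have h0 := hq0 s
    have hU0 : 0 ≤ x₁ s ^ 2 + x₂ s ^ 2 := by positivity
    have e1 : 0 ≤ ((1 - rp * p s + ε)⁻¹ + 4)
        * ((y₁ s - ω * x₂ s) ^ 2 + (y₂ s + ω * x₁ s) ^ 2) := by positivity
    have e2 := mul_le_mul_of_nonneg_right (hredshift s).2 hU0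
    have e3 : |x₁ s * y₁ s + x₂ s * y₂ s| ≤ (x₁ s ^ 2 + x₂ s ^ 2) + (y₁ s ^ 2 + y₂ s ^ 2) :=
      abs_add_mul_le _ _ _ _
    have e4 := (abs_le.1 (hKR s (x₁ s * y₁ s + x₂ s * y₂ s))).2
    have e5 := mul_le_mul_of_nonneg_left e3 hK0.le
    linarith

lemma lintegral_ofReal_const_mul {k : ℝ} (hk : 0 ≤ k) (g : ℝ → ℝ) :
    ∫⁻ s, ENNReal.ofReal (k * g s) = ENNReal.ofReal k * ∫⁻ s, ENNReal.ofReal (g s) := by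
  simp_rw [ENNReal.ofReal_mul hk]
  exact lintegral_const_mul' _ _ ENNReal.ofReal_ne_top

/-- Removal of the regularisation in the redshift weight. -/
lemma lintegral_inv_weight_le {q N U : ℝ → ℝ} {a : ℝ} {I : ENNReal} (hq : Continuous q)
    (hN : Continuous N) (hU : Continuous U) (hq0 : ∀ s, 0 < q s)
    (h : ∀ ε : ℝ, 0 < ε → ε ≤ 1 →
      ∫⁻ s, ENNReal.ofReal (a * (q s / (q s + ε) ^ 2 * N s + q s ^ 2 * U s)) ≤ I) :
    ∫⁻ s, ENNReal.ofReal (a * ((q s)⁻¹ * N s + q s ^ 2 * U s)) ≤ I := by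
  set ε : ℕ → ℝ := fun n => 1 / ((n : ℝ) + 1) with hεdef
  have hε0 : ∀ n, 0 < ε n := fun n => Nat.one_div_pos_of_nat
  have hε1 : ∀ n, ε n ≤ 1 := fun n => by
    rw [hεdef]
    exact (div_le_one (by positivity)).2 (by linarith [n.cast_nonneg (α := ℝ)])
  have hlim : Filter.Tendsto ε Filter.atTop (nhds 0) := tendsto_one_div_add_atTop_nhds_zero_nat
  have hpt : ∀ s, Filter.Tendsto (fun n => ENNReal.ofReal
      (a * (q s / (q s + ε n) ^ 2 * N s + q s ^ 2 * U s))) Filter.atTop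
      (nhds (ENNReal.ofReal (a * ((q s)⁻¹ * N s + q s ^ 2 * U s)))) := fun s => by
    have hs := (hq0 s).ne'
    have h1 : Filter.Tendsto (fun n => q s / (q s + ε n) ^ 2) Filter.atTop (nhds (q s)⁻¹) := by
      have := (tendsto_const_nhds (x := q s)).div ((hlim.const_add (q s)).pow 2) (by simpa using hs)
      rwa [add_zero, show q s / q s ^ 2 = (q s)⁻¹ by field_simp] at this
    exact ENNReal.tendsto_ofReal (((h1.mul_const (N s)).add_const (q s ^ 2 * U s)).const_mul a)
  calc ∫⁻ s, ENNReal.ofReal (a * ((q s)⁻¹ * N s + q s ^ 2 * U s))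
      = ∫⁻ s, Filter.liminf (fun n => ENNReal.ofReal
        (a * (q s / (q s + ε n) ^ 2 * N s + q s ^ 2 * U s))) Filter.atTop :=
        lintegral_congr fun s => (hpt s).liminf_eq.symm
    _ ≤ Filter.liminf (fun n => ∫⁻ s, ENNReal.ofReal
        (a * (q s / (q s + ε n) ^ 2 * N s + q s ^ 2 * U s))) Filter.atTop := by
        refine lintegral_liminf_le fun n => ENNReal.measurable_ofReal.comp ?_
        refine Continuous.measurable ?_
        have : ∀ s, (q s + ε n) ^ 2 ≠ 0 := fun s =>
          pow_ne_zero 2 (add_pos (hq0 s) (hε0 n)).ne'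
        fun_prop (disch := assumption)
    _ ≤ I := Filter.liminf_le_of_frequently_le'
        (Filter.Frequently.of_forall fun n => h (ε n) (hε0 n) (hε1 n))

/-- A continuous integrable function has a bounded nonnegative primitive. -/
lemma exists_bounded_primitive {w : ℝ → ℝ} (hw : Continuous w) (hi : Integrable w) :
    ∃ (F : ℝ → ℝ) (A : ℝ), ∀ s, HasDerivAt F (w s) s ∧ 0 ≤ F s ∧ F s ≤ A := by
  set A := ∫ t, ‖w t‖
  have hb : ∀ s, |∫ t in (0 : ℝ)..s, w t| ≤ A := fun s =>
    (intervalIntegral.norm_integral_le_integral_norm_uIoc).trans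
      (setIntegral_le_integral hi.norm (Filter.Eventually.of_forall fun t => norm_nonneg (w t)))
  refine ⟨fun s => A + ∫ t in (0 : ℝ)..s, w t, 2 * A, fun s => ⟨?_, ?_, ?_⟩⟩
  · exact (intervalIntegral.integral_hasDerivAt_right (hw.intervalIntegrable _ _)
      hw.stronglyMeasurable.stronglyMeasurableAtFilter hw.continuousAt).const_add A
  · linarith [(abs_le.1 (hb s)).1]
  · linarith [(abs_le.1 (hb s)).2]

/-- Control of `u` with an integrable weight by the degenerate energy. -/
lemma exists_lintegral_weight_mul_le {p φ w : ℝ → ℝ} {rp c₁ : ℝ} (hrp : 0 < rp) (hc₁ : 0 < c₁)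
    (hp : ∀ s, HasDerivAt p (-(p s) ^ 2 * φ s) s) (hp0 : ∀ s, 0 < p s)
    (hq0 : ∀ s, 0 < 1 - rp * p s) (hφ : ∀ s, c₁ * (1 - rp * p s) ≤ φ s)
    (hw : Continuous w) (hi : Integrable w) (hw0 : ∀ s, 0 ≤ w s) :
    ∃ C : ℝ, 0 ≤ C ∧ ∀ (ω : ℝ) (x₁ x₂ y₁ y₂ : ℝ → ℝ), (∀ s, HasDerivAt x₁ (y₁ s) s) →
      (∀ s, HasDerivAt x₂ (y₂ s) s) → Continuous y₁ → Continuous y₂ →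
      Filter.Tendsto (fun s => x₁ s ^ 2 + x₂ s ^ 2) Filter.atTop (nhds 0) →
      ∫⁻ s, ENNReal.ofReal (w s * (x₁ s ^ 2 + x₂ s ^ 2)) ≤ ENNReal.ofReal C *
        ∫⁻ s, ENNReal.ofReal ((1 - rp * p s)⁻¹ * ((y₁ s - ω * x₂ s) ^ 2 + (y₂ s + ω * x₁ s) ^ 2)
          + (1 - rp * p s) ^ 2 * (x₁ s ^ 2 + x₂ s ^ 2)) := by
  obtain ⟨F, A, hF⟩ := exists_bounded_primitive hw hi
  have hA : 0 ≤ A := (hF 0).2.1.trans (hF 0).2.2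
  have hφ0 : ∀ s, 0 ≤ φ s := fun s => (mul_pos hc₁ (hq0 s)).le.trans (hφ s)
  have hanti : Antitone p := antitone_of_hasDerivAt_nonpos hp fun s => by
    have := mul_nonneg (sq_nonneg (p s)) (hφ0 s)
    simp only [Pi.zero_apply]
    linarith
  have hpc : Continuous p := continuous_iff_continuousAt.2 fun s => (hp s).continuousAt
  set q₀ := 1 - rp * p 0 with hq₀
  have hq₀0 : 0 < q₀ := hq0 0
  set b := (p 0 ^ 2 * c₁)⁻¹ with hb
  have hp00 := hp0 0
  have hb0 : 0 < b := by positivity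
  set f : ℝ → ℝ := fun s => Real.exp (b * (1 / rp - p s)) * F s with hf
  have hprp : ∀ s, p s ≤ 1 / rp := fun s => by
    rw [le_div_iff₀ hrp]; linarith [hq0 s]
  have hf0 : ∀ s, 0 ≤ f s := fun s => mul_nonneg (Real.exp_pos _).le (hF s).2.1
  have hfA : ∀ s, f s ≤ Real.exp (b / rp) * A := fun s => by
    refine mul_le_mul (Real.exp_le_exp.2 ?_) (hF s).2.2 (hF s).2.1 (Real.exp_pos _).le
    have := mul_pos hb0 (hp0 s)
    rw [mul_sub, mul_one_div]
    linarith
  have hf' : ∀ s, HasDerivAt f (b * p s ^ 2 * φ s * f s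
      + Real.exp (b * (1 / rp - p s)) * w s) s := fun s => by
    refine ((((hp s).const_sub (1 / rp)).const_mul b).exp.mul (hF s).1).congr_deriv ?_
    simp only [hf]
    ring
  set a := Real.exp (b / rp) * A with ha
  have ha0 : 0 ≤ a := by positivity
  refine ⟨a * (q₀⁻¹ + 1), by positivity, fun ω x₁ x₂ y₁ y₂ hx₁ hx₂ hy₁ hy₂ htop => ?_⟩
  have hx₁c : Continuous x₁ := continuous_iff_continuousAt.2 fun s => (hx₁ s).continuousAt
  have hx₂c : Continuous x₂ := continuous_iff_continuousAt.2 fun s => (hx₂ s).continuousAt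
  rw [← lintegral_ofReal_const_mul (by positivity)]
  have hJ : ∀ s, HasDerivAt (fun s => -(f s * (x₁ s ^ 2 + x₂ s ^ 2)))
      (-((b * p s ^ 2 * φ s * f s + Real.exp (b * (1 / rp - p s)) * w s) * (x₁ s ^ 2 + x₂ s ^ 2)
        + f s * (2 * (x₁ s * y₁ s + x₂ s * y₂ s)))) s := fun s => by
    refine ((hf' s).mul (((hx₁ s).pow 2).add ((hx₂ s).pow 2))).neg.congr_deriv ?_
    simp only [Pi.add_apply, Pi.pow_apply]
    push_cast
    ring
  refine lintegral_le_lintegral_of_hasDerivAt hJ (by fun_prop) ?_ ?_ ?_ ?_ ?_ ?_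
  · have : Continuous fun s => (1 - rp * p s)⁻¹ :=
      Continuous.inv₀ (by fun_prop) fun s => (hq0 s).ne'
    fun_prop
  · exact fun s => mul_nonneg (hw0 s) (by positivity)
  · intro s
    have := hq0 s
    positivity
  · intro s
    have h0 := hq0 s
    have hU0 : 0 ≤ x₁ s ^ 2 + x₂ s ^ 2 := by positivity
    have hN0 : 0 ≤ (y₁ s - ω * x₂ s) ^ 2 + (y₂ s + ω * x₁ s) ^ 2 := by positivity
    have hR := sq_le_mul_twisted_sq (x₁ s) (x₂ s) (y₁ s) (y₂ s) ω
    have hfs := hf0 s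
    have hfas := hfA s
    have hφs := hφ s
    have hws := hw0 s
    have hexp : 1 ≤ Real.exp (b * (1 / rp - p s)) :=
      Real.one_le_exp (mul_nonneg hb0.le (by linarith [hprp s]))
    have hqs : b * p s ^ 2 * φ s * f s + a * (q₀⁻¹ * (1 - rp * p s) ^ 2)
        ≥ f s * (1 - rp * p s) := by
      rcases le_total s 0 with hs | hs
      · have hps := hanti hs
        have e1 : 1 - rp * p s ≤ b * p s ^ 2 * φ s := by
          calc 1 - rp * p s = b * p 0 ^ 2 * (c₁ * (1 - rp * p s)) := by
                rw [hb]; field_simp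
            _ ≤ b * p s ^ 2 * φ s := by gcongr
        have e2 : 0 ≤ a * (q₀⁻¹ * (1 - rp * p s) ^ 2) := by positivity
        have e3 := mul_le_mul_of_nonneg_right e1 hfs
        linarith
      · have hps := mul_le_mul_of_nonneg_left (hanti hs) hrp.le
        have e1 : 1 - rp * p s ≤ q₀⁻¹ * (1 - rp * p s) ^ 2 := by
          rw [← div_eq_inv_mul, le_div_iff₀ hq₀0, sq]
          exact mul_le_mul_of_nonneg_left (by linarith) h0.le
        have e2 : 0 ≤ b * p s ^ 2 * φ s * f s := by
          have := hφ0 s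
          positivity
        have e3 := mul_le_mul hfas e1 h0.le ha0
        linarith
    generalize x₁ s * y₁ s + x₂ s * y₂ s = R at *
    generalize x₁ s ^ 2 + x₂ s ^ 2 = U at *
    generalize (y₁ s - ω * x₂ s) ^ 2 + (y₂ s + ω * x₁ s) ^ 2 = N at *
    generalize 1 - rp * p s = q at *
    generalize Real.exp (b * (1 / rp - p s)) = X at *
    have k1 : -2 * R ≤ q * U + q⁻¹ * N := by
      refine le_add_of_sq_le_four_mul (by positivity) (by positivity) ?_
      calc (-2 * R) ^ 2 = 4 * R ^ 2 := by ring
        _ ≤ 4 * (U * N) := by gcongr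
        _ = _ := by field_simp
    have k2 := mul_le_mul_of_nonneg_left k1 hfs
    have k3 := mul_le_mul_of_nonneg_right hqs hU0
    have k4 : f s * (q⁻¹ * N) ≤ a * (q⁻¹ * N) := by gcongr
    have k5 : w s * U ≤ X * w s * U := by
      gcongr
      exact le_mul_of_one_le_left hws hexp
    have k6 : 0 ≤ a * (q₀⁻¹ * (q⁻¹ * N)) := by positivity
    have k7 : 0 ≤ a * (q ^ 2 * U) := by positivity
    linarith
  · exact fun η hη => Filter.Eventually.of_forall fun s => by
      have := mul_nonneg (hf0 s) (by positivity : 0 ≤ x₁ s ^ 2 + x₂ s ^ 2)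
      linarith
  · intro η hη
    have hlim : Filter.Tendsto (fun s => a * (x₁ s ^ 2 + x₂ s ^ 2)) Filter.atTop (nhds 0) := by
      simpa only [mul_zero] using htop.const_mul a
    filter_upwards [hlim.eventually_le_const hη] with s hs
    have := mul_le_mul_of_nonneg_right (hfA s) (by positivity : 0 ≤ x₁ s ^ 2 + x₂ s ^ 2)
    linarith

lemma weight_le {δ a : ℝ} (hδ0 : 0 < δ) (hδ1 : δ < 1) (ha : 0 ≤ a) :
    (a ^ (1 + δ) + 1)⁻¹ ≤ 4 * (1 + a) ^ (-(1 + δ)) := by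
  have h0 : 0 ≤ 1 + δ := by linarith
  have h2 : (2 : ℝ) ^ (1 + δ) ≤ 4 := by
    calc (2 : ℝ) ^ (1 + δ) ≤ (2 : ℝ) ^ (2 : ℝ) :=
          Real.rpow_le_rpow_of_exponent_le one_le_two (by linarith)
      _ = 4 := by norm_num
  have ha' : 0 ≤ a ^ (1 + δ) := Real.rpow_nonneg ha _
  have key : (1 + a) ^ (1 + δ) ≤ 4 * (a ^ (1 + δ) + 1) := by
    rcases le_total a 1 with h | h
    · have := Real.rpow_le_rpow (by linarith) (by linarith : 1 + a ≤ 2) h0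
      linarith
    · have := Real.rpow_le_rpow (by linarith) (by linarith : 1 + a ≤ 2 * a) h0
      rw [Real.mul_rpow zero_le_two ha] at this
      have := mul_le_mul_of_nonneg_right h2 ha'
      linarith
  have hpos : 0 < (1 + a) ^ (1 + δ) := Real.rpow_pos_of_pos (by linarith) _
  rw [Real.rpow_neg (by linarith), inv_le_iff_one_le_mul₀ (by linarith), ← div_eq_mul_inv,
    div_mul_eq_mul_div, one_le_div hpos]
  exact key

lemma norm_add_I_mul_sq (z w : ℂ) (ω : ℝ) :
    ‖z + Complex.I * (ω : ℂ) * w‖ ^ 2 = (z.re - ω * w.im) ^ 2 + (z.im + ω * w.re) ^ 2 := by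
  rw [Complex.sq_norm, Complex.normSq_apply]
  simp
  ring

lemma norm_sq_eq_re_im (z : ℂ) : ‖z‖ ^ 2 = z.re ^ 2 + z.im ^ 2 := by
  rw [Complex.sq_norm, Complex.normSq_apply]
  ring

lemma WeaklyOutgoing.exists_eventually_le {ω : ℝ} {u : ℝ → ℂ} (h : WeaklyOutgoing ω u) :
    ∃ b : ℝ, ∀ᶠ s in Filter.atBot, ‖u s‖ ^ 2 ≤ b := by
  obtain ⟨⟨c, h1, -⟩, -⟩ := h
  have h2 := h1.norm.eventually_le_const (u := 1) (by simp)
  refine ⟨(1 + ‖c‖) ^ 2, h2.mono fun s hs => ?_⟩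
  have e : ‖Complex.exp (-Complex.I * (ω : ℂ) * (s : ℂ))‖ = 1 := by
    rw [Complex.norm_exp]; simp
  gcongr
  calc ‖u s‖ = ‖(u s - c * Complex.exp (-Complex.I * (ω : ℂ) * (s : ℂ)))
        + c * Complex.exp (-Complex.I * (ω : ℂ) * (s : ℂ))‖ := by rw [sub_add_cancel]
    _ ≤ 1 + ‖c‖ := by
        refine (norm_add_le _ _).trans ?_
        rw [norm_mul, e, mul_one]
        linarith

lemma WeaklyOutgoing.tendsto_atBot {ω : ℝ} {u : ℝ → ℂ} (h : WeaklyOutgoing ω u) :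
    Filter.Tendsto (fun s => ‖deriv u s + Complex.I * (ω : ℂ) * u s‖ ^ 2) Filter.atBot
      (nhds 0) := by
  obtain ⟨⟨c, h1, h2⟩, -⟩ := h
  have h3 := ((h2.add (h1.const_mul (Complex.I * (ω : ℂ)))).norm.pow 2)
  simp only [mul_zero, add_zero, norm_zero, ne_eq, OfNat.ofNat_ne_zero, not_false_eq_true,
    zero_pow] at h3
  refine h3.congr fun s => ?_
  congr 2
  ring

lemma WeaklyOutgoing.tendsto_atTop {ω : ℝ} {u : ℝ → ℂ} (h : WeaklyOutgoing ω u) :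
    Filter.Tendsto (fun s => ‖u s‖ ^ 2) Filter.atTop (nhds 0) ∧
      Filter.Tendsto (fun s => ‖deriv u s‖ ^ 2) Filter.atTop (nhds 0) := by
  obtain ⟨-, ε, hε, h⟩ := h
  have hle : ∀ᶠ s in Filter.atTop, ‖u s‖ + ‖deriv u s‖
      ≤ Real.exp (ε * s) * (‖u s‖ + ‖deriv u s‖) := by
    filter_upwards [Filter.eventually_ge_atTop 0] with s hs
    exact le_mul_of_one_le_left (by positivity) (Real.one_le_exp (by positivity))
  have hsum := squeeze_zero' (Filter.Eventually.of_forall fun s => by positivity) hle h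
  have h1 := squeeze_zero (fun s => norm_nonneg (u s))
    (fun s => le_add_of_nonneg_right (norm_nonneg (deriv u s))) hsum
  have h2 := squeeze_zero (fun s => norm_nonneg (deriv u s))
    (fun s => le_add_of_nonneg_left (norm_nonneg (u s))) hsum
  exact ⟨by simpa using h1.pow 2, by simpa using h2.pow 2⟩

/-- The degenerate energy estimate, with constants independent of the angular momentum and of the
frequency. -/
lemma exists_degenerate_energy_le {p φ : ℝ → ℝ} {rm rp M E m c₁ C₁ : ℝ}
    (hrm : 0 ≤ rm) (hrp : 0 < rp) (hlt : rm < rp) (hc₁ : 0 < c₁) (hC₁ : 0 < C₁) (hM : 0 < M)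
    (hm : 0 < m) (hMrp : M ≤ rp) (hEM : E ^ 2 ≤ M ^ 2) (hsum : rm + rp = 2 * M)
    (hprod : rm * rp = E ^ 2)
    (hp : ∀ s, HasDerivAt p (-(p s) ^ 2 * φ s) s) (hp0 : ∀ s, 0 < p s)
    (hq0 : ∀ s, 0 < 1 - rp * p s)
    (hφ1 : ∀ s, c₁ * (1 - rp * p s) ≤ φ s) (hφ2 : ∀ s, φ s ≤ C₁ * (1 - rp * p s)) :
    ∃ A₀ C Λ₀ : ℝ, 0 < A₀ ∧ 0 < C ∧ ∀ (Λ l ω b : ℝ) (x₁ x₂ y₁ y₂ h₁ h₂ : ℝ → ℝ),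
      Λ₀ ≤ Λ → Λ ≤ l → 6 ≤ l → ω ^ 2 ≤ m ^ 2 → A₀ / Λ ≤ m ^ 2 - ω ^ 2 →
      (∀ s, HasDerivAt x₁ (y₁ s) s) → (∀ s, HasDerivAt x₂ (y₂ s) s) →
      (∀ s, HasDerivAt y₁ ((-ω ^ 2 + (1 - rp * p s) * (1 - rm * p s) * (m ^ 2 + l * p s ^ 2
        + (2 * M * p s ^ 3 - 2 * E ^ 2 * p s ^ 4))) * x₁ s + h₁ s) s) →
      (∀ s, HasDerivAt y₂ ((-ω ^ 2 + (1 - rp * p s) * (1 - rm * p s) * (m ^ 2 + l * p s ^ 2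
        + (2 * M * p s ^ 3 - 2 * E ^ 2 * p s ^ 4))) * x₂ s + h₂ s) s) →
      Continuous h₁ → Continuous h₂ →
      (∀ᶠ s in Filter.atBot, x₁ s ^ 2 + x₂ s ^ 2 ≤ b) →
      Filter.Tendsto (fun s => (y₁ s - ω * x₂ s) ^ 2 + (y₂ s + ω * x₁ s) ^ 2)
        Filter.atBot (nhds 0) →
      Filter.Tendsto (fun s => x₁ s ^ 2 + x₂ s ^ 2) Filter.atTop (nhds 0) →
      Filter.Tendsto (fun s => y₁ s ^ 2 + y₂ s ^ 2) Filter.atTop (nhds 0) →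
      ∫⁻ s, ENNReal.ofReal ((1 - rp * p s)⁻¹ * ((y₁ s - ω * x₂ s) ^ 2 + (y₂ s + ω * x₁ s) ^ 2)
          + (1 - rp * p s) ^ 2 * (x₁ s ^ 2 + x₂ s ^ 2))
        ≤ ENNReal.ofReal (C * Λ ^ 2)
          * ∫⁻ s, ENNReal.ofReal ((1 - rp * p s)⁻¹ * (h₁ s ^ 2 + h₂ s ^ 2)) := by
  obtain ⟨g₀, hg₀'⟩ : ∃ g₀, g₀ = 1 - rm / rp := ⟨_, rfl⟩
  have hg₀ : 0 < g₀ := by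
    rw [hg₀', sub_pos, div_lt_one hrp]
    exact hlt
  obtain ⟨γ, hγ⟩ : ∃ γ, γ = g₀ / 96 := ⟨_, rfl⟩
  have hγ0 : 0 < γ := by rw [hγ]; positivity
  obtain ⟨K, hK⟩ : ∃ K, K = 16 * C₁ / (rp * γ) := ⟨_, rfl⟩
  have hK0 : 0 < K := by rw [hK]; positivity
  obtain ⟨A₀, hA₀⟩ : ∃ A₀, A₀ = 2 * M ^ 2 * m ^ 4 / γ := ⟨_, rfl⟩
  have hA0 : 0 < A₀ := by rw [hA₀]; positivity
  obtain ⟨c, hc, hcc₁, hcK, hcm, hcA⟩ : ∃ c, 0 < c ∧ c ≤ c₁ / (4 * rp) ∧ c ≤ K / 32 ∧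
      c ≤ K * A₀ / (64 * m ^ 2) ∧ c ≤ K * A₀ / 4 :=
    ⟨min (min (c₁ / (4 * rp)) (K / 32)) (min (K * A₀ / (64 * m ^ 2)) (K * A₀ / 4)),
      by simp only [lt_min_iff]; refine ⟨⟨?_, ?_⟩, ?_, ?_⟩ <;> positivity,
      (min_le_left _ _).trans (min_le_left _ _), (min_le_left _ _).trans (min_le_right _ _),
      (min_le_right _ _).trans (min_le_left _ _), (min_le_right _ _).trans (min_le_right _ _)⟩
  obtain ⟨Λ₀, h1, h2, h3⟩ : ∃ Λ₀ : ℝ, 1 ≤ Λ₀ ∧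
      K * (2 * M * m ^ 2 / rp + 2 * C₁ ^ 2 / rp ^ 2) / (c₁ * g₀ / (16 * rp ^ 3)) ≤ Λ₀ ∧
      2 * C₁ ^ 2 / γ ≤ Λ₀ :=
    ⟨max 1 (max (K * (2 * M * m ^ 2 / rp + 2 * C₁ ^ 2 / rp ^ 2) / (c₁ * g₀ / (16 * rp ^ 3)))
      (2 * C₁ ^ 2 / γ)), le_max_left _ _, (le_max_left _ _).trans (le_max_right _ _),
      (le_max_right _ _).trans (le_max_right _ _)⟩
  refine ⟨A₀, 4 * (81 + K ^ 2) / c ^ 2, Λ₀, hA0, by positivity, fun Λ l ω b x₁ x₂ y₁ y₂ h₁ h₂ hΛ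
    hΛl hl hω hωA hx₁ hx₂ hy₁ hy₂ hh₁ hh₂ hbotU hbotN htopU htopD => ?_⟩
  have hΛ1 := h2.trans hΛ
  have hΛ2 := h3.trans hΛ
  rw [div_le_iff₀' (by positivity)] at hΛ1 hΛ2
  have hΛ0 : 1 ≤ Λ := h1.trans hΛ
  have hpc : Continuous p := continuous_iff_continuousAt.2 fun s => (hp s).continuousAt
  have hx₁c : Continuous x₁ := continuous_iff_continuousAt.2 fun s => (hx₁ s).continuousAt
  have hx₂c : Continuous x₂ := continuous_iff_continuousAt.2 fun s => (hx₂ s).continuousAt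
  have hy₁c : Continuous y₁ := continuous_iff_continuousAt.2 fun s => (hy₁ s).continuousAt
  have hy₂c : Continuous y₂ := continuous_iff_continuousAt.2 fun s => (hy₂ s).continuousAt
  have key := lintegral_inv_weight_le (q := fun s => 1 - rp * p s)
    (N := fun s => (y₁ s - ω * x₂ s) ^ 2 + (y₂ s + ω * x₁ s) ^ 2)
    (U := fun s => x₁ s ^ 2 + x₂ s ^ 2) (by fun_prop) (by fun_prop) (by fun_prop) hq0
    fun ε hε hε1 => lintegral_regularized_le hrm hrp hc₁ hC₁ hg₀ hM hm hMrp hEM hsum hprod hg₀' hγ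
      hK hA₀ hΛ0 hΛl hl hΛ1 hΛ2 hc hcc₁ hcK hcm hcA hω hωA hε hε1 hp hp0 hq0 hφ1 hφ2 hx₁ hx₂ hy₁
      hy₂ hh₁ hh₂ hbotU hbotN htopU htopD
  rw [lintegral_ofReal_const_mul (by positivity)] at key
  have hpos : 0 < c / (2 * Λ) := by positivity
  have e' : 4 * (81 + K ^ 2) / c ^ 2 * Λ ^ 2
      = (2 * Λ / c) * (2 * Λ / c * (81 + K ^ 2)) := by
    field_simp
    norm_num
  rw [e', ENNReal.ofReal_mul (by positivity), mul_assoc,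
    ← lintegral_ofReal_const_mul (k := 2 * Λ / c * (81 + K ^ 2)) (by positivity)]
  calc _ = ENNReal.ofReal (2 * Λ / c) * (ENNReal.ofReal (c / (2 * Λ)) * _) := by
        rw [← mul_assoc, ← ENNReal.ofReal_mul (by positivity),
          show 2 * Λ / c * (c / (2 * Λ)) = 1 by field_simp, ENNReal.ofReal_one, one_mul]
    _ ≤ _ := by gcongr

lemma HasDerivAt.re_complex {f : ℝ → ℂ} {f' : ℂ} {s : ℝ} (h : HasDerivAt f f' s) :
    HasDerivAt (fun t => (f t).re) f'.re s :=
  Complex.reCLM.hasFDerivAt.comp_hasDerivAt s h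

lemma HasDerivAt.im_complex {f : ℝ → ℂ} {f' : ℂ} {s : ℝ} (h : HasDerivAt f f' s) :
    HasDerivAt (fun t => (f t).im) f'.im s :=
  Complex.imCLM.hasFDerivAt.comp_hasDerivAt s h

lemma integrable_one_add_abs_rpow {δ : ℝ} (hδ : 0 < δ) :
    Integrable fun t : ℝ => (1 + |t|) ^ (-(1 + δ)) :=
  integrable_one_add_norm (by simpa using hδ)

lemma continuous_one_add_abs_rpow (a : ℝ) : Continuous fun t : ℝ => (1 + |t|) ^ a :=
  (continuous_const.add continuous_abs).rpow_const fun t =>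
    Or.inl (add_pos_of_pos_of_nonneg one_pos (abs_nonneg t)).ne'

/-- Pointwise domination of the energy density by the degenerate and the weighted densities. -/
lemma energy_density_le {m ω q q₀ w w₀ N U D : ℝ} (hq0 : 0 < q) (hq1 : q ≤ 1) (hw1 : w ≤ 1)
    (hw : 0 ≤ w) (hU : 0 ≤ U) (hN : 0 ≤ N) (hω : ω ^ 2 ≤ m ^ 2)
    (hD : D ≤ 2 * N + 2 * ω ^ 2 * U) (hwU : w ≤ 4 * w₀ + (q₀ ^ 2)⁻¹ * q ^ 2) :
    q⁻¹ * N + w * (D + U) ≤ (3 + (2 * m ^ 2 + 1) * (q₀ ^ 2)⁻¹) * (q⁻¹ * N + q ^ 2 * U)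
      + 4 * (2 * m ^ 2 + 1) * (w₀ * U) := by
  have e1 : w * (D + U) ≤ w * (2 * N + (2 * m ^ 2 + 1) * U) := by
    have := mul_le_mul_of_nonneg_right hω hU
    exact mul_le_mul_of_nonneg_left (by linarith) hw
  have e2 : w * (2 * N) ≤ 2 * (q⁻¹ * N) := by
    have h1 : w ≤ q⁻¹ := hw1.trans ((one_le_inv₀ hq0).2 hq1)
    have := mul_le_mul_of_nonneg_right h1 hN
    linarith
  have e3 := mul_le_mul_of_nonneg_left (mul_le_mul_of_nonneg_right hwU hU)
    (by positivity : 0 ≤ 2 * m ^ 2 + 1)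
  have e4 : 0 ≤ (2 * m ^ 2 + 1) * (q₀ ^ 2)⁻¹ * (q⁻¹ * N) := by positivity
  have e5 : 0 ≤ q ^ 2 * U := by positivity
  linarith

/-- Morawetz-type estimate in the regime . -/
theorem statement5
    (M m E : ℝ) (hM : 0 < M) (hm : 0 < m) (hE : |E| < M)
    (rm rp κ : ℝ)
    (hrm : rm = M - Real.sqrt (M ^ 2 - E ^ 2))
    (hrp : rp = M + Real.sqrt (M ^ 2 - E ^ 2))
    (hκ : κ = (M * rp - E ^ 2) / rp ^ 3)
    (rofs : ℝ → ℝ)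
    (hr1 : ∀ s : ℝ, rp < rofs s)
    (hr2 : ∀ s : ℝ, rofs s + (2 * κ)⁻¹ * Real.log ((rofs s - rm) * (rofs s - rp)) = s) :
    ∀ δ : ℝ, δ ∈ Set.Ioo (0 : ℝ) 1 →
    ∃ A₀ C : ℝ, 0 < A₀ ∧ 0 < C ∧ ∃ L₀ : ℕ, ∀ L : ℕ, L₀ ≤ L →
    ∀ ω : ℝ, 0 ≤ ω → ω < m → A₀ / (L : ℝ) ^ 2 ≤ m ^ 2 - ω ^ 2 →
    ∀ H u : ℝ → ℂ, Continuous H → ContDiff ℝ 2 u →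
    (∀ s : ℝ, deriv (deriv u) s - (Vpot M m E rofs ω L s : ℂ) * u s = H s) →
    WeaklyOutgoing ω u →
    (∫⁻ s : ℝ,
        ENNReal.ofReal (rofs s / (rofs s - rp) * ‖deriv u s + Complex.I * (ω : ℂ) * u s‖ ^ 2
          + ((max 0 (-s)) ^ (1 + δ) + 1)⁻¹ * (‖deriv u s‖ ^ 2 + ‖u s‖ ^ 2)))
      ≤ ENNReal.ofReal (C * (L : ℝ) ^ 4) *
        ∫⁻ s : ℝ, ENNReal.ofReal (rofs s / (rofs s - rp) * ‖H s‖ ^ 2) := by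
  rintro δ ⟨hδ0, hδ1⟩
  have hEM : E ^ 2 < M ^ 2 := sq_lt_sq' (by linarith [neg_abs_le E]) ((le_abs_self E).trans_lt hE)
  have hS0 : 0 < √(M ^ 2 - E ^ 2) := Real.sqrt_pos.2 (by linarith)
  have hS2 : √(M ^ 2 - E ^ 2) ^ 2 = M ^ 2 - E ^ 2 := Real.sq_sqrt (by linarith)
  have hSM : √(M ^ 2 - E ^ 2) ≤ M := by
    rw [Real.sqrt_le_left hM.le]
    linarith [sq_nonneg E]
  have hrm0 : 0 ≤ rm := by linarith
  have hMrp : M ≤ rp := by linarith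
  have hrp0 : 0 < rp := by linarith
  have hlt : rm < rp := by linarith
  have hsum : rm + rp = 2 * M := by linarith
  have hprod : rm * rp = E ^ 2 := by
    rw [hrm, hrp]
    linarith
  have hκ0 : 0 < κ := by
    rw [hκ]
    have := mul_le_mul_of_nonneg_left hMrp hM.le
    exact div_pos (by linarith) (by positivity)
  obtain ⟨φ, c₁, C₁, hc₁, hC₁, hφ⟩ :=
    exists_hasDerivAt_radius hrp0 hlt (by positivity : 0 < (2 * κ)⁻¹) hr1 hr2
  have hr0 : ∀ s, 0 < rofs s := fun s => hrp0.trans (hr1 s)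
  obtain ⟨p, hp_eq⟩ : ∃ p : ℝ → ℝ, p = fun s => (rofs s)⁻¹ := ⟨_, rfl⟩
  have hpr : ∀ s, p s = (rofs s)⁻¹ := fun s => by rw [hp_eq]
  have hp : ∀ s, HasDerivAt p (-(p s) ^ 2 * φ s) s := fun s => by
    rw [hp_eq]
    refine ((hφ s).1.inv (hr0 s).ne').congr_deriv ?_
    simp only [inv_pow]
    ring
  have hp0 : ∀ s, 0 < p s := fun s => by
    rw [hpr]
    exact inv_pos.2 (hr0 s)
  have hweight : ∀ s, rofs s / (rofs s - rp) = (1 - rp * p s)⁻¹ := fun s => by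
    have h1 := (hr0 s).ne'
    have h2 : rofs s - rp ≠ 0 := (sub_pos.2 (hr1 s)).ne'
    rw [hpr, show 1 - rp * (rofs s)⁻¹ = (rofs s - rp) / rofs s by field_simp, inv_div]
  have hq0 : ∀ s, 0 < 1 - rp * p s := fun s => by
    rw [← inv_pos, ← hweight]
    exact div_pos (hr0 s) (sub_pos.2 (hr1 s))
  have hq1 : ∀ s, 1 - rp * p s ≤ 1 := fun s => by
    have := mul_pos hrp0 (hp0 s)
    linarith
  have hφ1 : ∀ s, c₁ * (1 - rp * p s) ≤ φ s := fun s => by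
    rw [hpr]
    exact (hφ s).2.1
  have hφ2 : ∀ s, φ s ≤ C₁ * (1 - rp * p s) := fun s => by
    rw [hpr]
    exact (hφ s).2.2
  have hV : ∀ (ω : ℝ) (L : ℕ) (s : ℝ), Vpot M m E rofs ω L s
      = -ω ^ 2 + (1 - rp * p s) * (1 - rm * p s) * (m ^ 2 + (L : ℝ) * ((L : ℝ) + 1) * p s ^ 2
        + (2 * M * p s ^ 3 - 2 * E ^ 2 * p s ^ 4)) := fun ω L s => by
    have h1 := (hr0 s).ne'
    rw [Vpot, hpr, ← hsum, ← hprod]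
    field_simp
    ring
  have hanti : Antitone p := antitone_of_hasDerivAt_nonpos hp fun s => by
    have := mul_nonneg (sq_nonneg (p s)) ((mul_pos hc₁ (hq0 s)).le.trans (hφ1 s))
    simp only [Pi.zero_apply]
    linarith
  obtain ⟨A₀, C, Λ₀, hA₀, hC, hdeg⟩ := exists_degenerate_energy_le hrm0 hrp0 hlt hc₁ hC₁ hM hm hMrp
    hEM.le hsum hprod hp hp0 hq0 hφ1 hφ2
  obtain ⟨C', hC', hwt⟩ := exists_lintegral_weight_mul_le hrp0 hc₁ hp hp0 hq0 hφ1
    (continuous_one_add_abs_rpow (-(1 + δ))) (integrable_one_add_abs_rpow hδ0)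
    (fun s => by positivity)
  set q₀ := 1 - rp * p 0 with hq₀
  have hq₀0 : 0 < q₀ := hq0 0
  obtain ⟨k, hk⟩ : ∃ k, k = 3 + (2 * m ^ 2 + 1) * (q₀ ^ 2)⁻¹ := ⟨_, rfl⟩
  obtain ⟨k', hk'⟩ : ∃ k', k' = 4 * (2 * m ^ 2 + 1) := ⟨_, rfl⟩
  have hk0 : 0 < k := by rw [hk]; positivity
  have hk0' : 0 < k' := by rw [hk']; positivity
  refine ⟨A₀, (k + k' * C') * C, hA₀, by positivity, max 2 ⌈Λ₀⌉₊, fun L hL ω hω0 hωm hωA H u hH hu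
    hrad hout => ?_⟩
  have hL2 : (2 : ℝ) ≤ L := by exact_mod_cast (le_max_left _ _).trans hL
  have hLΛ : Λ₀ ≤ L := (Nat.le_ceil Λ₀).trans (by exact_mod_cast (le_max_right _ _).trans hL)
  have hLsq : 2 * (L : ℝ) ≤ (L : ℝ) ^ 2 := by
    rw [sq]
    exact mul_le_mul_of_nonneg_right hL2 (by linarith)
  have hωm2 : ω ^ 2 ≤ m ^ 2 := pow_le_pow_left₀ hω0 hωm.le 2
  have hu1 : ∀ s, HasDerivAt u (deriv u s) s := fun s =>
    (hu.differentiable (by norm_num) s).hasDerivAt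
  have hud : ContDiff ℝ 1 (deriv u) := hu.deriv'
  have hu2 : ∀ s, HasDerivAt (deriv u) ((Vpot M m E rofs ω L s : ℂ) * u s + H s) s := fun s =>
    ((hud.differentiable (by norm_num) s).hasDerivAt).congr_deriv (by rw [← hrad s]; ring)
  have hudc : Continuous (deriv u) := hud.continuous
  have huc : Continuous u := hu.continuous
  have hu_re := Complex.continuous_re.comp huc
  have hu_im := Complex.continuous_im.comp huc
  have hud_re := Complex.continuous_re.comp hudc
  have hud_im := Complex.continuous_im.comp hudc
  simp only [Function.comp_def] at hu_re hu_im hud_re hud_im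
  have hx₁ := fun s => (hu1 s).re_complex
  have hx₂ := fun s => (hu1 s).im_complex
  have hy₁ := fun s => ((hu2 s).re_complex).congr_deriv (show _ = _ by
    rw [Complex.add_re, Complex.re_ofReal_mul, hV])
  have hy₂ := fun s => ((hu2 s).im_complex).congr_deriv (show _ = _ by
    rw [Complex.add_im, Complex.im_ofReal_mul, hV])
  obtain ⟨b, hb⟩ := hout.exists_eventually_le
  have hbot := hout.tendsto_atBot
  obtain ⟨htopU, htopD⟩ := hout.tendsto_atTop
  simp only [norm_add_I_mul_sq, hweight] at hbot ⊢
  simp only [norm_sq_eq_re_im] at hb htopU htopD ⊢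
  have hI := hdeg ((L : ℝ) ^ 2) (L * (L + 1)) ω b _ _ _ _ _ _ (by linarith) (by linarith)
    (by linarith) hωm2 hωA hx₁ hx₂ hy₁ hy₂ (Complex.continuous_re.comp hH)
    (Complex.continuous_im.comp hH) hb hbot htopU htopD
  have hW := hwt ω _ _ _ _ hx₁ hx₂ hud_re hud_im htopU
  have hpc : Continuous p := continuous_iff_continuousAt.2 fun s => (hp s).continuousAt
  have hqc : Continuous fun s => (1 - rp * p s)⁻¹ :=
    Continuous.inv₀ (by fun_prop) fun s => (hq0 s).ne'
  have hpt : ∀ s, (1 - rp * p s)⁻¹ * (((deriv u s).re - ω * (u s).im) ^ 2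
        + ((deriv u s).im + ω * (u s).re) ^ 2) + ((max 0 (-s)) ^ (1 + δ) + 1)⁻¹
        * ((deriv u s).re ^ 2 + (deriv u s).im ^ 2 + ((u s).re ^ 2 + (u s).im ^ 2))
      ≤ k * ((1 - rp * p s)⁻¹ * (((deriv u s).re - ω * (u s).im) ^ 2
        + ((deriv u s).im + ω * (u s).re) ^ 2)
        + (1 - rp * p s) ^ 2 * ((u s).re ^ 2 + (u s).im ^ 2))
        + k' * ((1 + |s|) ^ (-(1 + δ)) * ((u s).re ^ 2 + (u s).im ^ 2)) := fun s => by
    rw [hk, hk']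
    have hmax : 0 ≤ (max 0 (-s)) ^ (1 + δ) := Real.rpow_nonneg (le_max_left _ _) _
    have hw1 : ((max 0 (-s)) ^ (1 + δ) + 1)⁻¹ ≤ 1 := inv_le_one_of_one_le₀ (by linarith)
    refine energy_density_le (hq0 s) (hq1 s) hw1 (by positivity) (by positivity) (by positivity)
      hωm2 ?_ ?_
    · nlinarith [sq_nonneg ((deriv u s).re - 2 * ω * (u s).im),
        sq_nonneg ((deriv u s).im + 2 * ω * (u s).re)]
    · rcases le_total s 0 with hs | hs
      · have h := weight_le hδ0 hδ1 (neg_nonneg.2 hs)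
        rw [max_eq_right (neg_nonneg.2 hs), abs_of_nonpos hs]
        have := hq0 s
        have : 0 ≤ (q₀ ^ 2)⁻¹ * (1 - rp * p s) ^ 2 := by positivity
        linarith
      · have h1 : q₀ ≤ 1 - rp * p s := by
          have := mul_le_mul_of_nonneg_left (hanti hs) hrp0.le
          linarith
        have h2 : 1 ≤ (q₀ ^ 2)⁻¹ * (1 - rp * p s) ^ 2 := by
          rw [← div_eq_inv_mul, one_le_div (by positivity)]
          gcongr
        have h3 : 0 ≤ (1 + |s|) ^ (-(1 + δ)) := by positivity
        linarith
  calc _ ≤ ∫⁻ s, (ENNReal.ofReal (k * ((1 - rp * p s)⁻¹ * (((deriv u s).re - ω * (u s).im) ^ 2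
        + ((deriv u s).im + ω * (u s).re) ^ 2)
        + (1 - rp * p s) ^ 2 * ((u s).re ^ 2 + (u s).im ^ 2)))
        + ENNReal.ofReal (k' * ((1 + |s|) ^ (-(1 + δ)) * ((u s).re ^ 2 + (u s).im ^ 2)))) :=
        lintegral_mono fun s =>
          (ENNReal.ofReal_le_ofReal (hpt s)).trans ENNReal.ofReal_add_le
    _ ≤ _ := by
        rw [lintegral_add_left
          (Measurable.ennreal_ofReal (Continuous.measurable (by fun_prop)))]
        rw [lintegral_ofReal_const_mul hk0.le, lintegral_ofReal_const_mul hk0'.le]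
        refine (add_le_add_right (mul_le_mul_right hW _) _).trans ?_
        rw [← mul_assoc, ← ENNReal.ofReal_mul hk0'.le, ← add_mul,
          ← ENNReal.ofReal_add hk0.le (by positivity)]
        refine (mul_le_mul_right hI _).trans_eq ?_
        rw [← mul_assoc, ← ENNReal.ofReal_mul (by positivity)]
        congr 2
        ring
end
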